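/- Let (W,S) be an irreducible, infinite Coxeter system of finite rank. An element w ∈ W is essential if and only if W is generated by the set of reflections {t_α : α a positive root that is w-odd}. -/

import Mathlib

namespace CoxeterPaper

/-- The entry `-cos (π / m i j)` of the matrix of the standard bilinear form,
interpreted as `-1` when `m i j = ∞` (encoded as `0`). -/
noncomputable def formEntry {B : Type*} (M : CoxeterMatrix B) (i j : B) : ℝ :=
  if M i j = 0 then -1 else - Real.cos (Real.pi / (M i j : ℝ))

/-- The standard bilinear form associated to a Coxeter matrix, on `V = B → ℝ`
(with basis `{α_s : s ∈ S}` identified with the standard basis). -/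
noncomputable def bilin {B : Type*} [Fintype B] (M : CoxeterMatrix B) (v w : B → ℝ) : ℝ :=
  ∑ i, ∑ j, v i * w j * formEntry M i j

/-- The standard bilinear form is positive definite. -/
def IsPosDef {B : Type*} [Fintype B] (M : CoxeterMatrix B) : Prop :=
  ∀ v : B → ℝ, v ≠ 0 → 0 < bilin M v v

/-- The standard bilinear form is positive semidefinite. -/
def IsPosSemidef {B : Type*} [Fintype B] (M : CoxeterMatrix B) : Prop :=
  ∀ v : B → ℝ, 0 ≤ bilin M v v

/-- The Coxeter graph: vertices are the elements of `B`, and `i ≠ j` are adjacent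
iff `m i j ≥ 3` (including `m i j = ∞`, encoded as `0`), i.e. iff `m i j ≠ 2`. -/
def coxeterGraph {B : Type*} (M : CoxeterMatrix B) : SimpleGraph B :=
  SimpleGraph.fromRel fun i j => M i j ≠ 2

/-- A Coxeter matrix (system) is irreducible if its Coxeter graph is connected. -/
def IsIrreducible {B : Type*} (M : CoxeterMatrix B) : Prop := (coxeterGraph M).Connected

/-- The simple root `α_i`, as the `i`-th standard basis vector of `V = B → ℝ`. -/
noncomputable def simpleRoot {B : Type*} [DecidableEq B] (i : B) : B → ℝ := Pi.single i 1

/-- The reflection `σ_i : λ ↦ λ - 2 (α_i, λ) α_i` of the canonical geometric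
representation of a Coxeter system. -/
noncomputable def reflMap {B : Type*} [Fintype B] [DecidableEq B] (M : CoxeterMatrix B) (i : B) :
    Module.End ℝ (B → ℝ) :=
  LinearMap.id -
    (2 : ℝ) • (∑ j : B, formEntry M i j • (LinearMap.proj j : (B → ℝ) →ₗ[ℝ] ℝ)).smulRight
      (simpleRoot i)

/-- `ρ` is the canonical geometric representation `σ : W → GL(V)` of the Coxeter
system `cs`: the homomorphism sending each simple reflection `s_i` to `σ_i`
(such a homomorphism is unique, since the `s_i` generate `W`). -/
def IsGeometricRep {B W : Type*} [Fintype B] [DecidableEq B] [Group W] {M : CoxeterMatrix B}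
    (cs : CoxeterSystem M W) (ρ : W →* Module.End ℝ (B → ℝ)) : Prop :=
  ∀ i : B, ρ (cs.simple i) = reflMap M i

/-- `v` is a root: an element of `Φ = {w(α_i) : w ∈ W, i ∈ B}`. -/
def IsRoot {B W : Type*} [DecidableEq B] [Group W] (ρ : W →* Module.End ℝ (B → ℝ))
    (v : B → ℝ) : Prop :=
  ∃ (w : W) (i : B), v = ρ w (simpleRoot i)

/-- All coordinates of `v` in the basis of simple roots are `≥ 0`. -/
def IsPositiveVec {B : Type*} (v : B → ℝ) : Prop := ∀ i, 0 ≤ v i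

/-- All coordinates of `v` in the basis of simple roots are `≤ 0`. -/
def IsNegativeVec {B : Type*} (v : B → ℝ) : Prop := ∀ i, v i ≤ 0

/-- The root `α` separates `u` and `v`: `uα` and `vα` have opposite signs. -/
def Separates {B W : Type*} [Group W] (ρ : W →* Module.End ℝ (B → ℝ)) (u v : W)
    (α : B → ℝ) : Prop :=
  (IsPositiveVec (ρ u α) ∧ IsNegativeVec (ρ v α)) ∨
    (IsNegativeVec (ρ u α) ∧ IsPositiveVec (ρ v α))

/-- The root `α` is `w`-periodic: `w^m α = α` for some positive integer `m`. -/
def IsPeriodic {B W : Type*} [Group W] (ρ : W →* Module.End ℝ (B → ℝ)) (w : W)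
    (α : B → ℝ) : Prop :=
  ∃ m : ℕ, 0 < m ∧ ρ (w ^ m) α = α

/-- The set `{m ∈ ℤ : α separates w^m and w^(m+1)}`. -/
def sepSet {B W : Type*} [Group W] (ρ : W →* Module.End ℝ (B → ℝ)) (w : W)
    (α : B → ℝ) : Set ℤ :=
  {m : ℤ | Separates ρ (w ^ m) (w ^ (m + 1)) α}

/-- The root `α` is `w`-even: not `w`-periodic, and
`{m ∈ ℤ : α separates w^m and w^(m+1)}` is finite of even cardinality. -/
def IsWEven {B W : Type*} [Group W] (ρ : W →* Module.End ℝ (B → ℝ)) (w : W)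
    (α : B → ℝ) : Prop :=
  ¬ IsPeriodic ρ w α ∧ (sepSet ρ w α).Finite ∧ Even (sepSet ρ w α).ncard

/-- The root `α` is `w`-odd: not `w`-periodic, and
`{m ∈ ℤ : α separates w^m and w^(m+1)}` is finite of odd cardinality. -/
def IsWOdd {B W : Type*} [Group W] (ρ : W →* Module.End ℝ (B → ℝ)) (w : W)
    (α : B → ℝ) : Prop :=
  ¬ IsPeriodic ρ w α ∧ (sepSet ρ w α).Finite ∧ Odd (sepSet ρ w α).ncard

/-- A parabolic subgroup of `W` is a subgroup of the form `x W_I x⁻¹` with `x ∈ W`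
and `I ⊆ S`, where `W_I` is the (special) subgroup generated by `{s_i : i ∈ I}`. -/
def IsParabolic {B W : Type*} [Group W] {M : CoxeterMatrix B} (cs : CoxeterSystem M W)
    (P : Subgroup W) : Prop :=
  ∃ (x : W) (I : Set B),
    P = Subgroup.map (MulAut.conj x).toMonoidHom (Subgroup.closure (cs.simple '' I))

/-- An element of `W` is essential if it lies in no proper parabolic subgroup. -/
def IsEssential {B W : Type*} [Group W] {M : CoxeterMatrix B} (cs : CoxeterSystem M W)
    (w : W) : Prop :=
  ∀ P : Subgroup W, IsParabolic cs P → P ≠ ⊤ → w ∉ P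

section FormEntries

variable {B : Type*} (M : CoxeterMatrix B)

theorem formEntry_self (i : B) : formEntry M i i = 1 := by
  simp [formEntry]

theorem formEntry_comm (i j : B) : formEntry M i j = formEntry M j i := by
  simp [formEntry, M.symmetric i j]

theorem two_le_of_ne_zero {i j : B} (hij : i ≠ j) (h : M i j ≠ 0) : 2 ≤ M i j := by
  have := M.off_diagonal i j hij
  omega

theorem formEntry_nonpos {i j : B} (hij : i ≠ j) : formEntry M i j ≤ 0 := by
  unfold formEntry
  split_ifs with h
  · norm_num
  · have h2 : (2 : ℝ) ≤ M i j := by exact_mod_cast two_le_of_ne_zero M hij h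
    have : 0 ≤ Real.cos (Real.pi / (M i j : ℝ)) := by
      apply Real.cos_nonneg_of_neg_pi_div_two_le_of_le
      · have : 0 ≤ Real.pi / (M i j : ℝ) := by positivity
        linarith [Real.pi_pos]
      · gcongr
    linarith

theorem abs_formEntry_le_one (i j : B) : |formEntry M i j| ≤ 1 := by
  unfold formEntry
  split_ifs with h
  · norm_num
  · rw [abs_neg]
    exact Real.abs_cos_le_one _

theorem formEntry_eq_zero_iff {i j : B} (hij : i ≠ j) : formEntry M i j = 0 ↔ M i j = 2 := by
  unfold formEntry
  split_ifs with h
  · simp [h]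
  · have h2 := two_le_of_ne_zero M hij h
    constructor
    · intro hc
      by_contra hne
      have h3 : (2 : ℝ) < M i j := by exact_mod_cast lt_of_le_of_ne h2 (Ne.symm hne)
      have : 0 < Real.cos (Real.pi / (M i j : ℝ)) := by
        apply Real.cos_pos_of_mem_Ioo
        constructor
        · have : 0 ≤ Real.pi / (M i j : ℝ) := by positivity
          linarith [Real.pi_pos]
        · have := Real.pi_pos
          gcongr
      linarith
    · intro h
      simp [h]

/-- The coefficients of the roots in a rank two parabolic subsystem. -/
noncomputable def dihedralCoeff (i j : B) (k : ℕ) : ℝ :=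
  if M i j = 0 then k
  else Real.sin (k * (Real.pi / (M i j : ℝ))) / Real.sin (Real.pi / (M i j : ℝ))

theorem sin_pi_div_pos {i j : B} (hij : i ≠ j) (h : M i j ≠ 0) :
    0 < Real.sin (Real.pi / (M i j : ℝ)) := by
  have h2 : (2 : ℝ) ≤ M i j := by exact_mod_cast two_le_of_ne_zero M hij h
  apply Real.sin_pos_of_pos_of_lt_pi
  · have := Real.pi_pos
    positivity
  · have := Real.pi_pos
    apply div_lt_self this
    linarith

theorem dihedralCoeff_zero (i j : B) : dihedralCoeff M i j 0 = 0 := by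
  simp [dihedralCoeff]

theorem dihedralCoeff_one {i j : B} (hij : i ≠ j) : dihedralCoeff M i j 1 = 1 := by
  unfold dihedralCoeff
  split_ifs with h
  · simp
  · rw [Nat.cast_one, one_mul]
    exact div_self (sin_pi_div_pos M hij h).ne'

theorem dihedralCoeff_add_two (i j : B) (k : ℕ) :
    dihedralCoeff M i j (k + 2) =
      -2 * formEntry M i j * dihedralCoeff M i j (k + 1) - dihedralCoeff M i j k := by
  unfold dihedralCoeff formEntry
  split_ifs with h
  · push_cast
    ring
  · have h1 := Real.sin_add ((k + 1 : ℝ) * (Real.pi / (M i j : ℝ))) (Real.pi / (M i j : ℝ))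
    have h2 := Real.sin_sub ((k + 1 : ℝ) * (Real.pi / (M i j : ℝ))) (Real.pi / (M i j : ℝ))
    have e1 : ((k + 2 : ℕ) : ℝ) * (Real.pi / (M i j : ℝ)) =
      (k + 1 : ℝ) * (Real.pi / (M i j : ℝ)) + Real.pi / (M i j : ℝ) := by push_cast; ring
    have e2 : (k : ℝ) * (Real.pi / (M i j : ℝ)) =
      (k + 1 : ℝ) * (Real.pi / (M i j : ℝ)) - Real.pi / (M i j : ℝ) := by ring
    rw [e1, e2, h1, h2]
    push_cast
    ring

theorem dihedralCoeff_nonneg {i j : B} (hij : i ≠ j) {k : ℕ} (hk : M i j = 0 ∨ k ≤ M i j) :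
    0 ≤ dihedralCoeff M i j k := by
  unfold dihedralCoeff
  split_ifs with h
  · positivity
  · have hk' : (k : ℝ) ≤ M i j := by exact_mod_cast hk.resolve_left h
    have hpos : (0 : ℝ) < M i j := by exact_mod_cast Nat.pos_of_ne_zero h
    apply div_nonneg _ (sin_pi_div_pos M hij h).le
    apply Real.sin_nonneg_of_nonneg_of_le_pi
    · have := Real.pi_pos
      positivity
    · calc (k : ℝ) * (Real.pi / (M i j : ℝ)) ≤ M i j * (Real.pi / (M i j : ℝ)) := by
            have := Real.pi_pos
            gcongr
        _ = Real.pi := by field_simp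

theorem dihedralCoeff_comm (i j : B) (k : ℕ) : dihedralCoeff M i j k = dihedralCoeff M j i k := by
  simp [dihedralCoeff, M.symmetric i j]

end FormEntries

section Form

variable {B : Type*} [Fintype B] (M : CoxeterMatrix B)

/-- The value `(α_i, v)` of the standard bilinear form. -/
noncomputable def simplePair (i : B) (v : B → ℝ) : ℝ := ∑ j, formEntry M i j * v j

theorem bilin_eq_sum_simplePair (u v : B → ℝ) : bilin M u v = ∑ i, u i * simplePair M i v := by
  unfold bilin simplePair
  refine Finset.sum_congr rfl fun i _ ↦ ?_
  rw [Finset.mul_sum]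
  exact Finset.sum_congr rfl fun j _ ↦ by ring

theorem bilin_comm (u v : B → ℝ) : bilin M u v = bilin M v u := by
  unfold bilin
  rw [Finset.sum_comm]
  refine Finset.sum_congr rfl fun i _ ↦ Finset.sum_congr rfl fun j _ ↦ ?_
  rw [formEntry_comm M j i]
  ring

theorem simplePair_sub_smul (i : B) (u v : B → ℝ) (a : ℝ) :
    simplePair M i (u - a • v) = simplePair M i u - a * simplePair M i v := by
  simp only [simplePair, Pi.sub_apply, Pi.smul_apply, smul_eq_mul, Finset.mul_sum,
    ← Finset.sum_sub_distrib]
  exact Finset.sum_congr rfl fun j _ ↦ by ring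

theorem simplePair_smul_add_smul (i : B) (u v : B → ℝ) (a b : ℝ) :
    simplePair M i (a • u + b • v) = a * simplePair M i u + b * simplePair M i v := by
  simp only [simplePair, Pi.add_apply, Pi.smul_apply, smul_eq_mul, Finset.mul_sum,
    ← Finset.sum_add_distrib]
  exact Finset.sum_congr rfl fun j _ ↦ by ring

theorem bilin_sub_smul_left (u v z : B → ℝ) (a : ℝ) :
    bilin M (u - a • v) z = bilin M u z - a * bilin M v z := by
  simp only [bilin_eq_sum_simplePair, Pi.sub_apply, Pi.smul_apply, smul_eq_mul, Finset.mul_sum,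
    ← Finset.sum_sub_distrib]
  exact Finset.sum_congr rfl fun j _ ↦ by ring

variable [DecidableEq B]

theorem simplePair_simpleRoot (i j : B) : simplePair M i (simpleRoot j) = formEntry M i j := by
  simp [simplePair, simpleRoot, Pi.single_apply]

theorem bilin_simpleRoot_left (i : B) (v : B → ℝ) :
    bilin M (simpleRoot i) v = simplePair M i v := by
  simp [bilin_eq_sum_simplePair, simpleRoot, Pi.single_apply]

theorem reflMap_apply (i : B) (v : B → ℝ) :
    reflMap M i v = v - (2 * simplePair M i v) • simpleRoot i := by
  simp [reflMap, simplePair, smul_smul]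

theorem bilin_reflMap (i : B) (u v : B → ℝ) :
    bilin M (reflMap M i u) (reflMap M i v) = bilin M u v := by
  simp only [reflMap_apply]
  rw [bilin_sub_smul_left, bilin_comm M u, bilin_sub_smul_left, bilin_simpleRoot_left,
    bilin_simpleRoot_left, simplePair_sub_smul, simplePair_simpleRoot, formEntry_self,
    bilin_comm M v u]
  ring

end Form

section SignVectors

variable {B : Type*}

theorem isPositiveVec_neg {v : B → ℝ} : IsPositiveVec (-v) ↔ IsNegativeVec v := by
  simp [IsPositiveVec, IsNegativeVec]

theorem isNegativeVec_neg {v : B → ℝ} : IsNegativeVec (-v) ↔ IsPositiveVec v := by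
  simp [IsPositiveVec, IsNegativeVec]

theorem IsPositiveVec.eq_zero {v : B → ℝ} (h : IsPositiveVec v) (h' : IsNegativeVec v) : v = 0 :=
  funext fun i ↦ le_antisymm (h' i) (h i)

theorem isPositiveVec_simpleRoot [DecidableEq B] (i : B) :
    IsPositiveVec (simpleRoot i : B → ℝ) := by
  intro j
  by_cases h : j = i <;> simp [simpleRoot, h]

theorem IsPositiveVec.smul_add_smul {u v : B → ℝ} (hu : IsPositiveVec u) (hv : IsPositiveVec v)
    {a b : ℝ} (ha : 0 ≤ a) (hb : 0 ≤ b) : IsPositiveVec (a • u + b • v) := fun i ↦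
  add_nonneg (mul_nonneg ha (hu i)) (mul_nonneg hb (hv i))

end SignVectors

section General

variable {B W : Type*} [Group W]

theorem rep_inv_apply_rep (ρ : W →* Module.End ℝ (B → ℝ)) (w : W) (v : B → ℝ) :
    ρ w⁻¹ (ρ w v) = v := by
  rw [← Module.End.mul_apply, ← map_mul]
  simp

theorem rep_apply_rep_inv (ρ : W →* Module.End ℝ (B → ℝ)) (w : W) (v : B → ℝ) :
    ρ w (ρ w⁻¹ v) = v := by
  rw [← Module.End.mul_apply, ← map_mul]
  simp

theorem rep_mul_apply (ρ : W →* Module.End ℝ (B → ℝ)) (u w : W) (v : B → ℝ) :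
    ρ (u * w) v = ρ u (ρ w v) := by
  rw [map_mul, Module.End.mul_apply]

theorem isRoot_simpleRoot [DecidableEq B] (ρ : W →* Module.End ℝ (B → ℝ)) (i : B) :
    IsRoot ρ (simpleRoot i) :=
  ⟨1, i, by simp⟩

theorem IsRoot.rep [DecidableEq B] {ρ : W →* Module.End ℝ (B → ℝ)} {β : B → ℝ}
    (hβ : IsRoot ρ β) (w : W) : IsRoot ρ (ρ w β) := by
  obtain ⟨u, i, rfl⟩ := hβ
  exact ⟨w * u, i, by rw [rep_mul_apply]⟩

theorem exists_dihedral_factorization {M : CoxeterMatrix B} (cs : CoxeterSystem M W) (w : W)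
    (i j : B) (hi : ¬ cs.IsRightDescent w i) :
    ∃ (v : W) (k : ℕ), w = v * cs.wordProd (CoxeterSystem.alternatingWord i j k) ∧
      cs.length w = cs.length v + k ∧ ¬ cs.IsRightDescent v i ∧ ¬ cs.IsRightDescent v j := by
  induction hn : cs.length w generalizing w i j with
  | zero =>
    refine ⟨w, 0, by simp [CoxeterSystem.alternatingWord], by simp [hn], hi, fun h ↦ ?_⟩
    unfold CoxeterSystem.IsRightDescent at h
    omega
  | succ n ih =>
    by_cases hj : cs.IsRightDescent w j
    · have hl := cs.isRightDescent_iff.mp hj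
      obtain ⟨v, k, hw, hlen, hvj, hvi⟩ := ih (w * cs.simple j) j i
        (cs.isRightDescent_iff_not_isRightDescent_mul.mp hj) (by omega)
      refine ⟨v, k + 1, ?_, by omega, hvi, hvj⟩
      rw [CoxeterSystem.alternatingWord_succ, cs.wordProd_concat, ← mul_assoc, ← hw,
        cs.simple_mul_simple_cancel_right]
    · exact ⟨w, 0, by simp [CoxeterSystem.alternatingWord], by simp [hn], hi, hj⟩

end General

section Representation

variable {B W : Type*} [Fintype B] [DecidableEq B] [Group W] {M : CoxeterMatrix B}

variable {cs : CoxeterSystem M W} {ρ : W →* Module.End ℝ (B → ℝ)}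

theorem rep_simple_apply (hρ : IsGeometricRep cs ρ) (i : B) (v : B → ℝ) :
    ρ (cs.simple i) v = v - (2 * simplePair M i v) • simpleRoot i := by
  rw [hρ i, reflMap_apply]

theorem rep_simple_simpleRoot (hρ : IsGeometricRep cs ρ) (i : B) :
    ρ (cs.simple i) (simpleRoot i) = -simpleRoot i := by
  rw [rep_simple_apply hρ, simplePair_simpleRoot, formEntry_self, mul_one, two_smul]
  abel

theorem rep_simple_apply_of_ne (hρ : IsGeometricRep cs ρ) {i k : B} (h : k ≠ i) (v : B → ℝ) :
    ρ (cs.simple i) v k = v k := by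
  rw [rep_simple_apply hρ]
  simp [simpleRoot, h]

theorem bilin_rep (hρ : IsGeometricRep cs ρ) (w : W) (u v : B → ℝ) :
    bilin M (ρ w u) (ρ w v) = bilin M u v := by
  induction w using cs.simple_induction_left with
  | one => simp
  | mul_simple_left w i ih => rw [rep_mul_apply, rep_mul_apply, hρ i, bilin_reflMap, ih]

theorem rep_dihedral (hρ : IsGeometricRep cs ρ) {i j : B} (k n : ℕ) :
    ∃ a b : B, (a = i ∧ b = j ∨ a = j ∧ b = i) ∧
      ρ (cs.wordProd (CoxeterSystem.alternatingWord i j k))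
        (dihedralCoeff M i j (n + 1) • simpleRoot i + dihedralCoeff M i j n • simpleRoot j) =
      dihedralCoeff M i j (n + k + 1) • simpleRoot a +
        dihedralCoeff M i j (n + k) • simpleRoot b := by
  induction k generalizing i j n with
  | zero => exact ⟨i, j, Or.inl ⟨rfl, rfl⟩, by simp [CoxeterSystem.alternatingWord]⟩
  | succ k ih =>
    obtain ⟨a, b, hab, h⟩ := ih (i := j) (j := i) (n + 1)
    refine ⟨a, b, hab.symm, ?_⟩
    rw [CoxeterSystem.alternatingWord_succ, cs.wordProd_concat, rep_mul_apply]
    have : ρ (cs.simple j) (dihedralCoeff M i j (n + 1) • simpleRoot i +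
        dihedralCoeff M i j n • simpleRoot j) =
        dihedralCoeff M j i (n + 1 + 1) • simpleRoot j +
          dihedralCoeff M j i (n + 1) • simpleRoot i := by
      rw [rep_simple_apply hρ, simplePair_smul_add_smul, simplePair_simpleRoot,
        simplePair_simpleRoot, formEntry_self, dihedralCoeff_add_two, dihedralCoeff_comm M j i,
        dihedralCoeff_comm M j i]
      ext x
      simp only [Pi.add_apply, Pi.sub_apply, Pi.smul_apply, smul_eq_mul]
      ring
    rw [this, h, dihedralCoeff_comm M j i, dihedralCoeff_comm M j i]
    simp only [add_assoc, add_comm 1 k]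

theorem rep_simpleRoot_pos (hρ : IsGeometricRep cs ρ) {w : W} {i : B}
    (hi : ¬ cs.IsRightDescent w i) : IsPositiveVec (ρ w (simpleRoot i)) := by
  induction hn : cs.length w using Nat.strong_induction_on generalizing w i with
  | _ n ih =>
    by_cases hw : w = 1
    · simpa [hw] using isPositiveVec_simpleRoot i
    obtain ⟨j, hj⟩ := cs.exists_rightDescent_of_ne_one hw
    have hij : i ≠ j := fun h ↦ hi (h ▸ hj)
    obtain ⟨v, k, hvk, hlen, hvi, hvj⟩ := exists_dihedral_factorization cs w i j hi
    have hk : k ≠ 0 := by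
      rintro rfl
      simp only [CoxeterSystem.alternatingWord, cs.wordProd_nil, mul_one] at hvk
      exact hvj (hvk ▸ hj)
    have hpi := ih _ (by omega) hvi rfl
    have hpj := ih _ (by omega) hvj rfl
    have hkM : M i j = 0 ∨ k + 1 ≤ M i j := by
      by_contra! hcon
      apply cs.not_isReduced_alternatingWord j i (m := k + 1) (by rw [M.symmetric]; exact hcon.1)
        (by rw [M.symmetric]; exact hcon.2)
      have h1 := cs.not_isRightDescent_iff.mp hi
      have h2 : w * cs.simple i = v * cs.wordProd (CoxeterSystem.alternatingWord j i (k + 1)) := by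
        rw [CoxeterSystem.alternatingWord_succ, cs.wordProd_concat, ← mul_assoc, ← hvk]
      have h3 := cs.length_mul_le v (cs.wordProd (CoxeterSystem.alternatingWord j i (k + 1)))
      have h4 := cs.length_wordProd_le (CoxeterSystem.alternatingWord j i (k + 1))
      rw [CoxeterSystem.length_alternatingWord] at h4
      unfold CoxeterSystem.IsReduced
      rw [CoxeterSystem.length_alternatingWord]
      rw [← h2] at h3
      omega
    obtain ⟨a, b, hab, h⟩ := rep_dihedral hρ (i := i) (j := j) k 0
    rw [dihedralCoeff_zero, zero_add, dihedralCoeff_one M hij, one_smul, zero_smul, add_zero,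
      zero_add] at h
    rw [hvk, rep_mul_apply, h, map_add, map_smul, map_smul]
    have hc1 := dihedralCoeff_nonneg M hij hkM
    have hc2 := dihedralCoeff_nonneg M hij (k := k) (hkM.imp_right fun h ↦ by omega)
    rcases hab with ⟨rfl, rfl⟩ | ⟨rfl, rfl⟩
    · exact hpi.smul_add_smul hpj hc1 hc2
    · exact hpj.smul_add_smul hpi hc1 hc2

theorem rep_simpleRoot_neg (hρ : IsGeometricRep cs ρ) {w : W} {i : B}
    (hi : cs.IsRightDescent w i) : IsNegativeVec (ρ w (simpleRoot i)) := by
  have h := rep_simpleRoot_pos hρ (cs.isRightDescent_iff_not_isRightDescent_mul.mp hi)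
  rwa [rep_mul_apply, rep_simple_simpleRoot hρ, map_neg, isPositiveVec_neg] at h

theorem IsRoot.pos_or_neg (hρ : IsGeometricRep cs ρ) {β : B → ℝ} (hβ : IsRoot ρ β) :
    IsPositiveVec β ∨ IsNegativeVec β := by
  obtain ⟨w, i, rfl⟩ := hβ
  by_cases h : cs.IsRightDescent w i
  · exact Or.inr (rep_simpleRoot_neg hρ h)
  · exact Or.inl (rep_simpleRoot_pos hρ h)

theorem IsRoot.neg (hρ : IsGeometricRep cs ρ) {β : B → ℝ} (hβ : IsRoot ρ β) : IsRoot ρ (-β) := by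
  obtain ⟨u, i, rfl⟩ := hβ
  exact ⟨u * cs.simple i, i, by rw [rep_mul_apply, rep_simple_simpleRoot hρ, map_neg]⟩

theorem IsRoot.bilin_self (hρ : IsGeometricRep cs ρ) {β : B → ℝ} (hβ : IsRoot ρ β) :
    bilin M β β = 1 := by
  obtain ⟨u, i, rfl⟩ := hβ
  rw [bilin_rep hρ, bilin_simpleRoot_left, simplePair_simpleRoot, formEntry_self]

theorem IsRoot.ne_zero (hρ : IsGeometricRep cs ρ) {β : B → ℝ} (hβ : IsRoot ρ β) : β ≠ 0 := by
  rintro rfl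
  have := hβ.bilin_self hρ
  simp [bilin] at this

theorem IsRoot.not_neg_iff (hρ : IsGeometricRep cs ρ) {β : B → ℝ} (hβ : IsRoot ρ β) :
    ¬ IsNegativeVec β ↔ IsPositiveVec β :=
  ⟨fun h ↦ (hβ.pos_or_neg hρ).resolve_right h, fun h h' ↦ hβ.ne_zero hρ (h.eq_zero h')⟩

theorem IsRoot.not_pos_iff (hρ : IsGeometricRep cs ρ) {β : B → ℝ} (hβ : IsRoot ρ β) :
    ¬ IsPositiveVec β ↔ IsNegativeVec β :=
  ⟨fun h ↦ (hβ.pos_or_neg hρ).resolve_left h, fun h h' ↦ hβ.ne_zero hρ (h'.eq_zero h)⟩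

theorem IsRoot.one_le_sum_abs (hρ : IsGeometricRep cs ρ) {β : B → ℝ} (hβ : IsRoot ρ β) :
    1 ≤ ∑ i, |β i| := by
  have h1 : bilin M β β ≤ (∑ i, |β i|) * ∑ j, |β j| := by
    rw [Finset.sum_mul_sum]
    refine Finset.sum_le_sum fun i _ ↦ Finset.sum_le_sum fun j _ ↦ ?_
    calc β i * β j * formEntry M i j ≤ |β i * β j * formEntry M i j| := le_abs_self _
      _ = |β i| * |β j| * |formEntry M i j| := by rw [abs_mul, abs_mul]
      _ ≤ |β i| * |β j| * 1 := by
        gcongr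
        exact abs_formEntry_le_one M i j
      _ = |β i| * |β j| := mul_one _
  rw [hβ.bilin_self hρ] at h1
  have h0 : 0 ≤ ∑ i, |β i| := Finset.sum_nonneg fun i _ ↦ abs_nonneg _
  nlinarith

theorem IsRoot.rep_simple_pos (hρ : IsGeometricRep cs ρ) {β : B → ℝ} (hβ : IsRoot ρ β)
    (hpos : IsPositiveVec β) {i : B} (hne : β ≠ simpleRoot i) :
    IsPositiveVec (ρ (cs.simple i) β) := by
  rw [← (hβ.rep (cs.simple i)).not_neg_iff hρ]
  intro hneg
  apply hne
  have hk : ∀ k, k ≠ i → β k = 0 := fun k hk ↦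
    le_antisymm (rep_simple_apply_of_ne hρ hk β ▸ hneg k) (hpos k)
  have hβi : β = β i • simpleRoot i := by
    ext k
    by_cases h : k = i
    · subst h; simp [simpleRoot]
    · simp [simpleRoot, h, hk k h]
  have h1 := hβ.bilin_self hρ
  have h2 : bilin M β β = β i * β i := by
    rw [bilin_eq_sum_simplePair, Finset.sum_eq_single i]
    · congr 1
      rw [simplePair, Finset.sum_eq_single i]
      · rw [formEntry_self, one_mul]
      · intro k _ h
        rw [hk k h, mul_zero]
      · simp
    · intro k _ h
      rw [hk k h, zero_mul]
    · simp
  have h3 : β i = 1 := by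
    have := hpos i
    nlinarith
  rw [hβi, h3, one_smul]

/-- The set of positive roots made negative by `w`. -/
def inversionSet (ρ : W →* Module.End ℝ (B → ℝ)) (w : W) : Set (B → ℝ) :=
  {β | IsRoot ρ β ∧ IsPositiveVec β ∧ IsNegativeVec (ρ w β)}

theorem finite_inversionSet (hρ : IsGeometricRep cs ρ) (w : W) : (inversionSet ρ w).Finite := by
  induction w using cs.simple_induction_left with
  | one =>
    convert Set.finite_empty
    ext β
    simp only [inversionSet, Set.mem_ofPred_eq, Set.mem_empty_iff_false, iff_false]
    rintro ⟨h1, h2, h3⟩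
    rw [map_one] at h3
    exact h1.ne_zero hρ (h2.eq_zero h3)
  | mul_simple_left w i ih =>
    refine (ih.union (Set.finite_singleton (ρ w⁻¹ (simpleRoot i)))).subset ?_
    rintro β ⟨h1, h2, h3⟩
    by_cases h : IsNegativeVec (ρ w β)
    · exact Or.inl ⟨h1, h2, h⟩
    · right
      by_contra hne
      rw [rep_mul_apply] at h3
      have h4 := (h1.rep w).rep_simple_pos hρ (((h1.rep w).not_neg_iff hρ).mp h) (i := i)
        fun he ↦ hne (by rw [Set.mem_singleton_iff, ← he, rep_inv_apply_rep])
      exact (((h1.rep w).rep _).not_neg_iff hρ).mpr h4 h3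

theorem eq_one_of_rep_simpleRoot_pos (hρ : IsGeometricRep cs ρ) {w : W}
    (h : ∀ i, IsPositiveVec (ρ w (simpleRoot i))) : w = 1 := by
  by_contra hw
  obtain ⟨j, hj⟩ := cs.exists_rightDescent_of_ne_one hw
  exact (((isRoot_simpleRoot ρ j).rep w).not_neg_iff hρ).mpr (h j) (rep_simpleRoot_neg hρ hj)

theorem infinite_roots (hρ : IsGeometricRep cs ρ) [Infinite W] :
    {β : B → ℝ | IsRoot ρ β}.Infinite := by
  intro hfin
  have := hfin.to_subtype
  let F : W → (B → {β : B → ℝ | IsRoot ρ β}) := fun w i ↦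
    ⟨ρ w (simpleRoot i), (isRoot_simpleRoot ρ i).rep w⟩
  have hF : Function.Injective F := by
    intro u w huw
    have hi : ∀ i, ρ u (simpleRoot i) = ρ w (simpleRoot i) := fun i ↦
      congrArg Subtype.val (congrFun huw i)
    have : w⁻¹ * u = 1 := eq_one_of_rep_simpleRoot_pos hρ fun i ↦ by
      rw [rep_mul_apply, hi, rep_inv_apply_rep]
      exact isPositiveVec_simpleRoot i
    exact (inv_mul_eq_one.mp this).symm
  exact not_finite_iff_infinite.mpr ‹Infinite W› (Finite.of_injective F hF)

end Representation

section Cosets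

variable {B W : Type*} [Group W] {M : CoxeterMatrix B} {cs : CoxeterSystem M W}

theorem wordProd_mem {G : Subgroup W} {ω : List B} (h : ∀ i ∈ ω, cs.simple i ∈ G) :
    cs.wordProd ω ∈ G := by
  induction ω with
  | nil => simp
  | cons i ω ih =>
    rw [cs.wordProd_cons]
    exact G.mul_mem (h i (by simp)) (ih fun j hj ↦ h j (by simp [hj]))

theorem exists_minimal_coset_rep (cs : CoxeterSystem M W) (J : Set B) (w : W) :
    ∃ g v, w = g * v ∧ v ∈ Subgroup.closure (cs.simple '' J) ∧
      ∀ j ∈ J, ¬ cs.IsRightDescent g j := by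
  obtain ⟨g, hg, hmin⟩ := (measure cs.length).wf.has_min
    {g : W | g⁻¹ * w ∈ Subgroup.closure (cs.simple '' J)}
    ⟨w, by simp⟩
  refine ⟨g, g⁻¹ * w, by group, hg, fun j hj hd ↦ hmin (g * cs.simple j) ?_ hd⟩
  have : (g * cs.simple j)⁻¹ * w = cs.simple j * (g⁻¹ * w) := by
    rw [mul_inv_rev, cs.inv_simple, mul_assoc]
  rw [Set.mem_ofPred_eq, this]
  exact Subgroup.mul_mem _ (Subgroup.subset_closure ⟨j, hj, rfl⟩) hg

theorem eq_univ_of_orthogonal_compl (hirr : IsIrreducible M) {I : Set B} (hI : I.Nonempty)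
    (h : ∀ i ∈ I, ∀ k ∉ I, formEntry M i k = 0) : I = Set.univ := by
  obtain ⟨i, hi⟩ := hI
  rw [Set.eq_univ_iff_forall]
  intro k
  obtain ⟨p⟩ := hirr.preconnected i k
  induction p with
  | nil => exact hi
  | cons hadj _ ih =>
    refine ih ?_
    by_contra hk
    obtain ⟨hne, hor⟩ := (SimpleGraph.fromRel_adj _ _ _).mp hadj
    have h2 := (formEntry_eq_zero_iff M hne).mp (h _ hi _ hk)
    rw [M.symmetric, or_self] at hor
    exact hor (by rw [M.symmetric]; exact h2)

end Cosets

section Parabolic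

variable {B W : Type*} [Fintype B] [DecidableEq B] [Group W] {M : CoxeterMatrix B}
  {cs : CoxeterSystem M W} {ρ : W →* Module.End ℝ (B → ℝ)}

theorem rep_apply_of_mem_closure (hρ : IsGeometricRep cs ρ) {I : Set B} {u : W}
    (hu : u ∈ Subgroup.closure (cs.simple '' I)) {k : B} (hk : k ∉ I) (v : B → ℝ) :
    ρ u v k = v k := by
  induction hu using Subgroup.closure_induction generalizing v with
  | mem y hy =>
    obtain ⟨i, hi, rfl⟩ := hy
    exact rep_simple_apply_of_ne hρ (by rintro rfl; exact hk hi) v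
  | one => simp
  | mul a b _ _ iha ihb => rw [rep_mul_apply, iha, ihb]
  | inv a _ iha => rw [← iha (ρ a⁻¹ v), rep_apply_rep_inv]

theorem eq_univ_of_closure_eq_top (hρ : IsGeometricRep cs ρ) {I : Set B}
    (h : Subgroup.closure (cs.simple '' I) = ⊤) : I = Set.univ := by
  rw [Set.eq_univ_iff_forall]
  by_contra! hk
  obtain ⟨k, hk⟩ := hk
  have := rep_apply_of_mem_closure hρ (h ▸ Subgroup.mem_top (cs.simple k)) hk (simpleRoot k)
  rw [rep_simple_simpleRoot hρ] at this
  simp only [simpleRoot, Pi.neg_apply, Pi.single_eq_same] at this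
  norm_num at this

theorem IsEssential.eq_univ_of_mem_closure {w : W} (hw : IsEssential cs w)
    (hρ : IsGeometricRep cs ρ) {I : Set B} (h : w ∈ Subgroup.closure (cs.simple '' I)) :
    I = Set.univ := by
  by_contra hI
  refine hw _ ⟨1, I, ?_⟩ (fun htop ↦ hI (eq_univ_of_closure_eq_top hρ htop)) h
  ext y
  simp

theorem eq_sum_smul_simpleRoot (v : B → ℝ) : v = ∑ i, v i • simpleRoot i := by
  ext k
  simp [simpleRoot, Finset.sum_apply, Pi.single_apply]

theorem apply_eq_sum (x : (B → ℝ) →ₗ[ℝ] ℝ) (v : B → ℝ) :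
    x v = ∑ i, v i * x (simpleRoot i) := by
  conv_lhs => rw [eq_sum_smul_simpleRoot v]
  simp

theorem isPositiveVec_map (f : Module.End ℝ (B → ℝ)) {J : Set B}
    (hf : ∀ j ∈ J, IsPositiveVec (f (simpleRoot j))) {v : B → ℝ} (hv : IsPositiveVec v)
    (hvJ : ∀ k, k ∉ J → v k = 0) : IsPositiveVec (f v) := by
  intro i
  rw [eq_sum_smul_simpleRoot v]
  simp only [map_sum, map_smul, Finset.sum_apply, Pi.smul_apply, smul_eq_mul]
  refine Finset.sum_nonneg fun j _ ↦ ?_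
  by_cases hj : j ∈ J
  · exact mul_nonneg (hv j) (hf j hj i)
  · rw [hvJ j hj, zero_mul]

theorem formEntry_eq_zero_of_fixed (hρ : IsGeometricRep cs ρ) {ω : List B} (hω : cs.IsReduced ω)
    {k : B} (hk : k ∉ ω) (hfix : ρ (cs.wordProd ω) (simpleRoot k) = simpleRoot k) :
    ∀ i ∈ ω, formEntry M i k = 0 := by
  induction ω using List.reverseRecOn with
  | nil => simp
  | append_singleton l i ih =>
    have hred : cs.IsReduced l := by simpa using hω.take l.length
    have hki : i ≠ k := fun h ↦ hk (by simp [h])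
    set g := cs.wordProd (l ++ [i]) with hg
    have hgl : g = cs.wordProd l * cs.simple i := by rw [hg, cs.wordProd_append]; simp
    have hneg : IsNegativeVec (ρ g (simpleRoot i)) := by
      apply rep_simpleRoot_neg hρ
      unfold CoxeterSystem.IsRightDescent
      rw [hω.eq, hgl, cs.simple_mul_simple_cancel_right, hred.eq]
      simp
    have hmem : g ∈ Subgroup.closure (cs.simple '' {j | j ∈ l ++ [i]}) :=
      wordProd_mem fun j hj ↦ Subgroup.subset_closure ⟨j, hj, rfl⟩
    have hsupp : ρ g (simpleRoot i) k = 0 := by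
      rw [rep_apply_of_mem_closure hρ hmem hk]
      simp [simpleRoot, hki.symm]
    have hbil : bilin M (ρ g (simpleRoot i)) (simpleRoot k) = formEntry M i k := by
      rw [← hfix, bilin_rep hρ, bilin_simpleRoot_left, simplePair_simpleRoot]
    have hzero : formEntry M i k = 0 := by
      apply le_antisymm (formEntry_nonpos M hki)
      rw [← hbil, bilin_eq_sum_simplePair]
      refine Finset.sum_nonneg fun j _ ↦ ?_
      rw [simplePair_simpleRoot]
      by_cases hjk : j = k
      · rw [hjk, hsupp, zero_mul]
      · exact mul_nonneg_of_nonpos_of_nonpos (hneg j) (formEntry_nonpos M hjk)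
    have hfix' : ρ (cs.wordProd l) (simpleRoot k) = simpleRoot k := by
      rw [hgl, rep_mul_apply, rep_simple_apply hρ, simplePair_simpleRoot, hzero] at hfix
      simpa using hfix
    intro j hj
    rcases List.mem_append.mp hj with h | h
    · exact ih hred (fun h ↦ hk (by simp [h])) hfix' j h
    · rw [List.mem_singleton.mp h, hzero]

theorem simple_mem_of_inversions (hρ : IsGeometricRep cs ρ) {ω : List B} (hω : cs.IsReduced ω)
    {G : Subgroup W} (hG : ∀ (u : W) (i : B), IsPositiveVec (ρ u (simpleRoot i)) →
      IsNegativeVec (ρ (cs.wordProd ω)⁻¹ (ρ u (simpleRoot i))) → u * cs.simple i * u⁻¹ ∈ G)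
    {i : B} (hi : i ∈ ω) : cs.simple i ∈ G := by
  suffices h : ∀ l₁ l₂ : List B, ω = l₁ ++ l₂ → ∀ i ∈ l₁, cs.simple i ∈ G from
    h ω [] (by simp) i hi
  intro l₁
  induction l₁ using List.reverseRecOn with
  | nil => simp
  | append_singleton l i ih =>
    intro l₂ h j hj
    have hl := ih (i :: l₂) (by simp [h])
    rcases List.mem_append.mp hj with hj | hj
    · exact hl j hj
    rw [List.mem_singleton.mp hj]
    have hred : cs.IsReduced l := by simpa [h] using hω.take l.length
    have hred1 : cs.IsReduced (l ++ [i]) := by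
      rw [h] at hω
      simpa only [List.take_left] using hω.take (l ++ [i]).length
    have hred2 : cs.IsReduced (i :: l₂) := by simpa [h] using hω.drop l.length
    have hred3 : cs.IsReduced l₂ := by
      rw [h] at hω
      simpa only [List.drop_left] using hω.drop (l ++ [i]).length
    have hpos : IsPositiveVec (ρ (cs.wordProd l) (simpleRoot i)) := by
      apply rep_simpleRoot_pos hρ
      rw [cs.not_isRightDescent_iff, hred.eq]
      have := hred1.eq
      rw [cs.wordProd_append, cs.wordProd_singleton] at this
      rw [this]
      simp
    have hpos2 : IsPositiveVec (ρ (cs.wordProd l₂)⁻¹ (simpleRoot i)) := by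
      apply rep_simpleRoot_pos hρ
      rw [cs.isRightDescent_inv_iff, cs.not_isLeftDescent_iff, hred3.eq, ← cs.wordProd_cons,
        hred2.eq]
      simp
    have hmem := hG _ _ hpos (by
      rw [← isPositiveVec_neg, h, ← rep_mul_apply, cs.wordProd_append, cs.wordProd_append,
        cs.wordProd_singleton]
      have : (cs.wordProd l * cs.simple i * cs.wordProd l₂)⁻¹ * cs.wordProd l =
          (cs.wordProd l₂)⁻¹ * cs.simple i := by
        rw [mul_inv_rev, mul_inv_rev, cs.inv_simple]
        group
      rw [this, rep_mul_apply, rep_simple_simpleRoot hρ, map_neg, neg_neg]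
      exact hpos2)
    have hlG : cs.wordProd l ∈ G := wordProd_mem hl
    have := G.mul_mem (G.mul_mem (G.inv_mem hlG) hmem) hlG
    simpa [mul_assoc] using this

/-- If `g` stabilises the sub-root-system of a special subgroup `W_J`, preserving positivity, and
`g` lies in `W_I`, then `g` fixes the simple roots indexed by `J \ I`. -/
theorem rep_fixes_simpleRoot (hρ : IsGeometricRep cs ρ) {g : W} {I J : Set B}
    (hg : g ∈ Subgroup.closure (cs.simple '' I))
    (hpos : ∀ j ∈ J, IsPositiveVec (ρ g (simpleRoot j)))
    (hsupp : ∀ j ∈ J, ∀ k ∉ J, ρ g (simpleRoot j) k = 0)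
    (hinv : ∀ j ∈ J, IsPositiveVec (ρ g⁻¹ (simpleRoot j)))
    {k : B} (hkJ : k ∈ J) (hkI : k ∉ I) : ρ g (simpleRoot k) = simpleRoot k := by
  have hcoord : ∀ m ∉ I, ρ g (simpleRoot k) m = (simpleRoot k : B → ℝ) m := fun m hm ↦
    rep_apply_of_mem_closure hρ hg hm _
  have hrest : IsPositiveVec (ρ g (simpleRoot k) - simpleRoot k) := by
    intro m
    by_cases hm : m ∈ I
    · have hmk : m ≠ k := fun h ↦ hkI (h ▸ hm)
      simpa [simpleRoot, hmk] using hpos k hkJ m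
    · simp [hcoord m hm]
  have hrestJ : ∀ m, m ∉ J → (ρ g (simpleRoot k) - simpleRoot k) m = 0 := by
    intro m hm
    have hmk : m ≠ k := fun h ↦ hm (h ▸ hkJ)
    simp only [Pi.sub_apply, hsupp k hkJ m hm]
    simp [simpleRoot, hmk]
  have h1 := isPositiveVec_map (ρ g⁻¹) hinv hrest hrestJ
  rw [map_sub, rep_inv_apply_rep] at h1
  have h2 : ρ g⁻¹ (simpleRoot k) = simpleRoot k := by
    ext m
    by_cases hm : m = k
    · rw [hm, rep_apply_of_mem_closure hρ (Subgroup.inv_mem _ hg) hkI]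
    · have h3 := h1 m
      have h4 := hinv k hkJ m
      simp only [Pi.sub_apply, simpleRoot, Pi.single_apply, hm, if_false] at h3 h4 ⊢
      linarith
  conv_lhs => rw [← h2]
  rw [rep_apply_rep_inv]

theorem IsEssential.closure_eq_top_of_axis (hρ : IsGeometricRep cs ρ) (hirr : IsIrreducible M)
    {w : W} (hw : IsEssential cs w) (x : (B → ℝ) →ₗ[ℝ] ℝ) (hdom : ∀ i, 0 ≤ x (simpleRoot i))
    (hne : ∃ i, x (simpleRoot i) ≠ 0)
    (hzero : ∀ β, IsRoot ρ β → (x (ρ w β) = 0 ↔ x β = 0)) {O : (B → ℝ) → Prop}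
    (hO : ∀ β, IsRoot ρ β → 0 < x β → x (ρ w⁻¹ β) < 0 → O β) :
    Subgroup.closure {t : W | ∃ (u : W) (i : B), t = u * cs.simple i * u⁻¹ ∧
      IsPositiveVec (ρ u (simpleRoot i)) ∧ O (ρ u (simpleRoot i))} = ⊤ := by
  set G := Subgroup.closure {t : W | ∃ (u : W) (i : B), t = u * cs.simple i * u⁻¹ ∧
      IsPositiveVec (ρ u (simpleRoot i)) ∧ O (ρ u (simpleRoot i))} with hG
  set J : Set B := {j | x (simpleRoot j) = 0} with hJ
  obtain ⟨g, v, hgv, hv, hmin⟩ := exists_minimal_coset_rep cs J w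
  have hxv : ∀ u ∈ Subgroup.closure (cs.simple '' J), ∀ z, x (ρ u z) = x z := by
    intro u hu
    induction hu using Subgroup.closure_induction with
    | mem y hy =>
      obtain ⟨j, hj, rfl⟩ := hy
      intro z
      have hj' : x (simpleRoot j) = 0 := hj
      rw [rep_simple_apply hρ, map_sub, map_smul, hj', smul_zero, sub_zero]
    | one => simp
    | mul a b _ _ iha ihb => intro z; rw [rep_mul_apply, iha, ihb]
    | inv a _ iha => intro z; rw [← iha (ρ a⁻¹ z), rep_apply_rep_inv]
  have hxg : ∀ β, IsRoot ρ β → (x (ρ g β) = 0 ↔ x β = 0) := by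
    intro β hβ
    have hg : g = w * v⁻¹ := by rw [hgv]; group
    rw [hg, rep_mul_apply, hzero _ (hβ.rep _), hxv _ (Subgroup.inv_mem _ hv)]
  have hxpos : ∀ β, IsPositiveVec β → 0 ≤ x β := fun β hβ ↦ by
    rw [apply_eq_sum]
    exact Finset.sum_nonneg fun i _ ↦ mul_nonneg (hβ i) (hdom i)
  have hsupp' : ∀ β, IsPositiveVec β → x β = 0 → ∀ k ∉ J, β k = 0 := by
    intro β hβ hx k hk
    rw [apply_eq_sum, Finset.sum_eq_zero_iff_of_nonneg
      fun i _ ↦ mul_nonneg (hβ i) (hdom i)] at hx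
    exact (mul_eq_zero.mp (hx k (Finset.mem_univ k))).resolve_right hk
  have hpos : ∀ j ∈ J, IsPositiveVec (ρ g (simpleRoot j)) := fun j hj ↦
    rep_simpleRoot_pos hρ (hmin j hj)
  have hsupp : ∀ j ∈ J, ∀ k ∉ J, ρ g (simpleRoot j) k = 0 := fun j hj ↦
    hsupp' _ (hpos j hj) ((hxg _ (isRoot_simpleRoot ρ j)).mpr hj)
  have hinv : ∀ j ∈ J, IsPositiveVec (ρ g⁻¹ (simpleRoot j)) := by
    intro j hj
    have hr := (isRoot_simpleRoot ρ j).rep g⁻¹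
    rw [← hr.not_neg_iff hρ, ← isPositiveVec_neg]
    intro hneg
    have h0 : x (-ρ g⁻¹ (simpleRoot j)) = 0 := by
      rw [map_neg, neg_eq_zero, ← hxg _ hr, rep_apply_rep_inv]
      exact hj
    have h1 := isPositiveVec_map (ρ g) hpos hneg (hsupp' _ hneg h0)
    rw [map_neg, rep_apply_rep_inv, isPositiveVec_neg] at h1
    exact ((isRoot_simpleRoot ρ j).not_neg_iff hρ).mpr (isPositiveVec_simpleRoot j) h1
  obtain ⟨ω, hω, hgω⟩ := cs.exists_isReduced g
  have hmemG : ∀ i ∈ ω, cs.simple i ∈ G := by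
    refine fun i hi ↦ simple_mem_of_inversions hρ hω (fun u i hu hneg ↦ ?_) hi
    refine Subgroup.subset_closure ⟨u, i, rfl, hu, ?_⟩
    rw [← hgω] at hneg
    have hr := (isRoot_simpleRoot ρ i).rep u
    have hne0 : x (ρ u (simpleRoot i)) ≠ 0 := fun h0 ↦
      ((hr.rep g⁻¹).not_neg_iff hρ).mpr (isPositiveVec_map (ρ g⁻¹) hinv hu (hsupp' _ hu h0)) hneg
    have hle : x (ρ g⁻¹ (ρ u (simpleRoot i))) ≤ 0 := by
      have := hxpos _ (isPositiveVec_neg.mpr hneg)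
      rw [map_neg] at this
      linarith
    have hne1 : x (ρ g⁻¹ (ρ u (simpleRoot i))) ≠ 0 := by
      rw [Ne, ← hxg _ (hr.rep _), rep_apply_rep_inv]
      exact hne0
    refine hO _ hr (lt_of_le_of_ne (hxpos _ hu) hne0.symm) ?_
    rw [hgv, mul_inv_rev, rep_mul_apply, hxv _ (Subgroup.inv_mem _ hv)]
    exact lt_of_le_of_ne hle hne1
  have hgI : g ∈ Subgroup.closure (cs.simple '' {i | i ∈ ω}) :=
    hgω ▸ wordProd_mem fun j hj ↦ Subgroup.subset_closure ⟨j, hj, rfl⟩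
  have hIJ : {i | i ∈ ω} ∪ J = Set.univ := by
    apply hw.eq_univ_of_mem_closure hρ
    rw [hgv, Set.image_union]
    exact Subgroup.mul_mem _ (Subgroup.closure_mono Set.subset_union_left hgI)
      (Subgroup.closure_mono Set.subset_union_right hv)
  have horth : ∀ i ∈ {i | i ∈ ω}, ∀ k ∉ {i | i ∈ ω}, formEntry M i k = 0 := by
    intro i hi k hk
    have hkJ : k ∈ J := ((Set.eq_univ_iff_forall.mp hIJ) k).resolve_left hk
    have hfix := rep_fixes_simpleRoot hρ hgI hpos hsupp hinv hkJ hk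
    exact formEntry_eq_zero_of_fixed hρ hω hk (hgω ▸ hfix) i hi
  rcases Set.eq_empty_or_nonempty {i | i ∈ ω} with hemp | hnonemp
  · rw [hemp, Set.empty_union] at hIJ
    obtain ⟨i, hi⟩ := hne
    exact absurd ((Set.eq_univ_iff_forall.mp hIJ) i) hi
  · have huniv := eq_univ_of_orthogonal_compl hirr hnonemp horth
    rw [eq_top_iff, ← cs.subgroup_closure_range_simple, Subgroup.closure_le]
    rintro _ ⟨i, rfl⟩
    exact hmemG i ((Set.eq_univ_iff_forall.mp huniv) i)

end Parabolic

section Parity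

open scoped Classical in
theorem even_card_filter_changes_iff (P : ℤ → Prop) (a : ℤ) (n : ℕ) :
    Even ((Finset.Ico a (a + n)).filter fun m ↦ ¬(P m ↔ P (m + 1))).card ↔ (P a ↔ P (a + n)) := by
  induction n with
  | zero => simp
  | succ n ih =>
    have hIco : Finset.Ico a (a + (n + 1 : ℕ)) = insert (a + (n : ℤ)) (Finset.Ico a (a + n)) := by
      ext m
      simp only [Finset.mem_Ico, Finset.mem_insert]
      push_cast
      omega
    rw [hIco, Finset.filter_insert]
    have hadd : a + ((n + 1 : ℕ) : ℤ) = a + n + 1 := by push_cast; ring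
    rw [hadd]
    split_ifs with h
    · rw [ih]
      tauto
    · rw [Finset.card_insert_of_notMem (by simp), Nat.even_add_one, ih]
      tauto

theorem exists_forall_iff_of_finite_changes (P : ℤ → Prop)
    (hfin : {m : ℤ | ¬(P m ↔ P (m + 1))}.Finite) :
    ∃ N : ℤ, 0 ≤ N ∧ (∀ m, N ≤ m → (P m ↔ P N)) ∧ (∀ m, m ≤ -N → (P m ↔ P (-N))) ∧
      (Even {m : ℤ | ¬(P m ↔ P (m + 1))}.ncard ↔ (P (-N) ↔ P N)) := by
  classical
  obtain ⟨u, hu⟩ := hfin.bddAbove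
  obtain ⟨l, hl⟩ := hfin.bddBelow
  set N : ℤ := max 0 (max (u + 1) (-l)) with hN
  have h0 : 0 ≤ N := le_max_left _ _
  have hsub : ∀ m, ¬(P m ↔ P (m + 1)) → -N ≤ m ∧ m < N := by
    intro m hm
    have h1 := hu hm
    have h2 := hl hm
    omega
  refine ⟨N, h0, ?_, ?_, ?_⟩
  · intro m hm
    induction m, hm using Int.leInduction with
    | base => exact Iff.rfl
    | succ m hm ih =>
      rw [← ih]
      by_contra hc
      have := hsub m (fun h ↦ hc h.symm)
      omega
  · intro m hm
    induction m, hm using Int.leInductionDown with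
    | base => exact Iff.rfl
    | pred m hm ih =>
      rw [← ih]
      by_contra hc
      have := hsub (m - 1) (by simpa using hc)
      omega
  · have hset : {m : ℤ | ¬(P m ↔ P (m + 1))} =
        ((Finset.Ico (-N) (-N + (2 * N).toNat)).filter fun m ↦ ¬(P m ↔ P (m + 1))) := by
      ext m
      simp only [Set.mem_ofPred_eq, Finset.coe_filter, Finset.mem_Ico]
      refine ⟨fun h ↦ ⟨?_, h⟩, fun h ↦ h.2⟩
      have := hsub m h
      omega
    rw [hset, Set.ncard_coe_finset, even_card_filter_changes_iff]
    have : -N + ((2 * N).toNat : ℤ) = N := by omega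
    rw [this]

end Parity

section Periodicity

variable {B W : Type*} [Group W] {ρ : W →* Module.End ℝ (B → ℝ)}

theorem rep_zpow_injective {w : W} {β : B → ℝ} (h : ¬ IsPeriodic ρ w β) :
    Function.Injective fun m : ℤ ↦ ρ (w ^ m) β := by
  have key : ∀ m n : ℤ, m < n → ρ (w ^ m) β ≠ ρ (w ^ n) β := by
    intro m n hmn he
    refine h ⟨(n - m).toNat, by omega, ?_⟩
    rw [← zpow_natCast, Int.toNat_of_nonneg (by omega), sub_eq_neg_add, zpow_add, rep_mul_apply,
      ← he, zpow_neg, rep_inv_apply_rep]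
  intro m n he
  by_contra hne
  rcases lt_or_gt_of_ne hne with h | h
  · exact key m n h he
  · exact key n m h he.symm

theorem isPeriodic_neg {w : W} {β : B → ℝ} : IsPeriodic ρ w (-β) ↔ IsPeriodic ρ w β := by
  simp [IsPeriodic]

theorem sepSet_neg {w : W} {β : B → ℝ} : sepSet ρ w (-β) = sepSet ρ w β := by
  ext m
  simp only [sepSet, Separates, map_neg, isPositiveVec_neg, isNegativeVec_neg, Set.mem_ofPred_eq]
  tauto

theorem isWOdd_neg {w : W} {β : B → ℝ} : IsWOdd ρ w (-β) ↔ IsWOdd ρ w β := by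
  simp only [IsWOdd, isPeriodic_neg, sepSet_neg]

end Periodicity

section Dynamics

variable {B W : Type*} [Fintype B] [DecidableEq B] [Group W] {M : CoxeterMatrix B}
  {cs : CoxeterSystem M W} {ρ : W →* Module.End ℝ (B → ℝ)}

theorem finite_setOf_mem_inversionSet (hρ : IsGeometricRep cs ρ) {w : W} {β : B → ℝ}
    (h : ¬ IsPeriodic ρ w β) (u : W) :
    {m : ℤ | ρ (w ^ m) β ∈ inversionSet ρ u ∨ -ρ (w ^ m) β ∈ inversionSet ρ u}.Finite := by
  have hinj := rep_zpow_injective h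
  exact ((finite_inversionSet hρ u).preimage hinj.injOn).union
    ((finite_inversionSet hρ u).preimage (neg_injective.comp hinj).injOn)

theorem sepSet_eq (hρ : IsGeometricRep cs ρ) {β : B → ℝ} (hβ : IsRoot ρ β) (w : W) :
    sepSet ρ w β =
      {m : ℤ | ¬(IsPositiveVec (ρ (w ^ m) β) ↔ IsPositiveVec (ρ (w ^ (m + 1)) β))} := by
  ext m
  simp only [sepSet, Separates, Set.mem_ofPred_eq, ← (hβ.rep (w ^ m)).not_pos_iff hρ,
    ← (hβ.rep (w ^ (m + 1))).not_pos_iff hρ]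
  tauto

theorem mem_inversionSet_of_changes (hρ : IsGeometricRep cs ρ) {β : B → ℝ} (hβ : IsRoot ρ β)
    {w : W} {m : ℤ}
    (h : ¬(IsPositiveVec (ρ (w ^ m) β) ↔ IsPositiveVec (ρ (w ^ (m + 1)) β))) :
    ρ (w ^ m) β ∈ inversionSet ρ w ∨ -ρ (w ^ m) β ∈ inversionSet ρ w := by
  have hr := hβ.rep (w ^ m)
  have hr' := hβ.rep (w ^ (m + 1))
  have he : ρ w (ρ (w ^ m) β) = ρ (w ^ (m + 1)) β := by
    rw [← rep_mul_apply, add_comm, zpow_add, zpow_one]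
  by_cases hp : IsPositiveVec (ρ (w ^ m) β)
  · refine Or.inl ⟨hr, hp, ?_⟩
    rw [he, ← hr'.not_pos_iff hρ]
    tauto
  · refine Or.inr ⟨hr.neg hρ, isPositiveVec_neg.mpr ((hr.not_pos_iff hρ).mp hp), ?_⟩
    rw [map_neg, isNegativeVec_neg, he]
    tauto

theorem finite_sepSet (hρ : IsGeometricRep cs ρ) {β : B → ℝ} (hβ : IsRoot ρ β) {w : W}
    (h : ¬ IsPeriodic ρ w β) : (sepSet ρ w β).Finite := by
  rw [sepSet_eq hρ hβ]
  exact (finite_setOf_mem_inversionSet hρ h w).subset fun m hm ↦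
    mem_inversionSet_of_changes hρ hβ hm

theorem IsWOdd.exists_forall_iff_not (hρ : IsGeometricRep cs ρ) {β : B → ℝ} (hβ : IsRoot ρ β)
    {w : W} (h : IsWOdd ρ w β) :
    ∃ N : ℤ, ∀ m, N ≤ m → (IsPositiveVec (ρ (w ^ (-m)) β) ↔ ¬ IsPositiveVec (ρ (w ^ m) β)) := by
  obtain ⟨-, hfin, hodd⟩ := h
  rw [sepSet_eq hρ hβ] at hfin hodd
  obtain ⟨N, -, h1, h2, h3⟩ :=
    exists_forall_iff_of_finite_changes (fun m ↦ IsPositiveVec (ρ (w ^ m) β)) hfin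
  rw [← Nat.not_even_iff_odd, h3] at hodd
  refine ⟨N, fun m hm ↦ ?_⟩
  have := h1 m hm
  have := h2 (-m) (by omega)
  tauto

theorem exists_finite_of_not_isWOdd (hρ : IsGeometricRep cs ρ) {β : B → ℝ} (hβ : IsRoot ρ β)
    {w : W} (hper : ¬ IsPeriodic ρ w β) (h : ¬ IsWOdd ρ w β) :
    {m : ℤ | ¬ IsPositiveVec (ρ (w ^ m) β)}.Finite ∨
      {m : ℤ | ¬ IsNegativeVec (ρ (w ^ m) β)}.Finite := by
  have hfin := finite_sepSet hρ hβ hper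
  have heven : Even (sepSet ρ w β).ncard := by
    rw [← Nat.not_odd_iff_even]
    exact fun ho ↦ h ⟨hper, hfin, ho⟩
  rw [sepSet_eq hρ hβ] at hfin heven
  obtain ⟨N, -, h1, h2, h3⟩ :=
    exists_forall_iff_of_finite_changes (fun m ↦ IsPositiveVec (ρ (w ^ m) β)) hfin
  rw [h3] at heven
  have hout : ∀ m, ¬(IsPositiveVec (ρ (w ^ m) β) ↔ IsPositiveVec (ρ (w ^ N) β)) →
      m ∈ Set.Ioo (-N) N := by
    intro m hm
    constructor
    · by_contra! hle
      have := h2 m hle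
      tauto
    · by_contra! hle
      exact hm (h1 m hle)
  by_cases hN : IsPositiveVec (ρ (w ^ N) β)
  · refine Or.inl ((Set.finite_Ioo (-N) N).subset fun m hm ↦ hout m ?_)
    rw [Set.mem_ofPred_eq] at hm
    tauto
  · refine Or.inr ((Set.finite_Ioo (-N) N).subset fun m hm ↦ hout m ?_)
    rw [Set.mem_ofPred_eq, (hβ.rep _).not_neg_iff hρ] at hm
    tauto

theorem IsWOdd.infinite_setOf_not_pos (hρ : IsGeometricRep cs ρ) {β : B → ℝ} (hβ : IsRoot ρ β)
    {w : W} (h : IsWOdd ρ w β) : {m : ℤ | ¬ IsPositiveVec (ρ (w ^ m) β)}.Infinite := by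
  intro hfin
  obtain ⟨N, hN⟩ := h.exists_forall_iff_not hρ hβ
  obtain ⟨u, hu⟩ := hfin.bddAbove
  obtain ⟨l, hl⟩ := hfin.bddBelow
  set m := max N (max (u + 1) (1 - l)) with hm
  have h1 : m ∉ {m : ℤ | ¬ IsPositiveVec (ρ (w ^ m) β)} := fun h ↦ by
    have := hu h
    omega
  have h2 : -m ∉ {m : ℤ | ¬ IsPositiveVec (ρ (w ^ m) β)} := fun h ↦ by
    have := hl h
    omega
  have := hN m (le_max_left _ _)
  simp only [Set.mem_ofPred_eq] at h1 h2
  tauto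

theorem IsWOdd.apply_eq_zero (hρ : IsGeometricRep cs ρ) {β : B → ℝ} (hβ : IsRoot ρ β)
    {w x u : W} (hw : w = x * u * x⁻¹) {I : Set B} (hu : u ∈ Subgroup.closure (cs.simple '' I))
    (h : IsWOdd ρ w β) {k : B} (hk : k ∉ I) : ρ x⁻¹ β k = 0 := by
  have hnn : ∀ γ : B → ℝ, IsRoot ρ γ → IsWOdd ρ w γ → ρ x⁻¹ γ k ≤ 0 := by
    intro γ hγ hodd
    by_contra! hpos
    have hcoord : ∀ m : ℤ, ρ (u ^ m) (ρ x⁻¹ γ) k = ρ x⁻¹ γ k := fun m ↦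
      rep_apply_of_mem_closure hρ (Subgroup.zpow_mem _ hu m) hk _
    have hp : ∀ m : ℤ, IsPositiveVec (ρ (u ^ m) (ρ x⁻¹ γ)) := fun m ↦ by
      rw [← ((hγ.rep _).rep _).not_neg_iff hρ]
      intro hneg
      have := hneg k
      rw [hcoord] at this
      linarith
    have hconj : ∀ m : ℤ, ρ (u ^ m) (ρ x⁻¹ γ) = ρ x⁻¹ (ρ (w ^ m) γ) := fun m ↦ by
      rw [← rep_mul_apply, ← rep_mul_apply, hw, conj_zpow]
      group
    refine hodd.infinite_setOf_not_pos hρ hγ ?_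
    have hinj : Function.Injective fun m : ℤ ↦ ρ (u ^ m) (ρ x⁻¹ γ) := by
      intro m n hmn
      simp only [hconj] at hmn
      apply rep_zpow_injective hodd.1
      simpa [rep_apply_rep_inv] using congrArg (ρ x) hmn
    refine ((finite_inversionSet hρ x).preimage hinj.injOn).subset fun m hm ↦ ?_
    refine ⟨(hγ.rep _).rep _, hp m, ?_⟩
    change IsNegativeVec (ρ x (ρ (u ^ m) (ρ x⁻¹ γ)))
    rw [hconj, rep_apply_rep_inv, ← (hγ.rep _).not_pos_iff hρ]
    exact hm
  apply le_antisymm (hnn β hβ h)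
  have := hnn (-β) (hβ.neg hρ) (isWOdd_neg.mpr h)
  simpa using this

theorem rep_conj_simple_apply (hρ : IsGeometricRep cs ρ) (y : W) (i : B) (v : B → ℝ) :
    ρ (y * cs.simple i * y⁻¹) v =
      v - (2 * simplePair M i (ρ y⁻¹ v)) • ρ y (simpleRoot i) := by
  rw [rep_mul_apply, rep_mul_apply, rep_simple_apply hρ, map_sub, map_smul, rep_apply_rep_inv]

theorem isEssential_of_closure_eq_top (hρ : IsGeometricRep cs ρ) {w : W}
    (h : Subgroup.closure {t : W | ∃ (x : W) (i : B), t = x * cs.simple i * x⁻¹ ∧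
      IsPositiveVec (ρ x (simpleRoot i)) ∧ IsWOdd ρ w (ρ x (simpleRoot i))} = ⊤) :
    IsEssential cs w := by
  rintro P ⟨x, I, rfl⟩ hP ⟨u, hu, hxu⟩
  have hw : w = x * u * x⁻¹ := by rw [← hxu]; rfl
  have hI : ∃ k, k ∉ I := by
    by_contra! hI
    apply hP
    rw [Set.eq_univ_iff_forall.mpr hI, Set.image_univ, cs.subgroup_closure_range_simple]
    exact Subgroup.map_top_of_surjective _ (MulAut.conj x).surjective
  obtain ⟨k, hk⟩ := hI
  have key : ∀ t ∈ Subgroup.closure {t : W | ∃ (x : W) (i : B), t = x * cs.simple i * x⁻¹ ∧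
      IsPositiveVec (ρ x (simpleRoot i)) ∧ IsWOdd ρ w (ρ x (simpleRoot i))},
      ∀ v, ρ x⁻¹ (ρ t v) k = ρ x⁻¹ v k := by
    intro t ht
    induction ht using Subgroup.closure_induction with
    | mem t ht =>
      obtain ⟨y, i, rfl, -, hodd⟩ := ht
      intro v
      rw [rep_conj_simple_apply hρ, map_sub, map_smul]
      simp [hodd.apply_eq_zero hρ ((isRoot_simpleRoot ρ i).rep y) hw hu hk]
    | one => simp
    | mul a b _ _ iha ihb => intro v; rw [rep_mul_apply, iha, ihb]
    | inv a _ iha => intro v; rw [← iha (ρ a⁻¹ v), rep_apply_rep_inv]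
  have := key (x * cs.simple k * x⁻¹) (h ▸ Subgroup.mem_top _) (ρ x (simpleRoot k))
  rw [rep_inv_apply_rep, rep_mul_apply, rep_inv_apply_rep, rep_mul_apply, rep_inv_apply_rep,
    rep_simple_simpleRoot hρ] at this
  simp only [simpleRoot, Pi.neg_apply, Pi.single_eq_same] at this
  norm_num at this

end Dynamics

section Generic

variable {B : Type*} [Fintype B] [DecidableEq B]

theorem exists_generic_functional {Z : Set (B → ℝ)} (hZ : Z.Countable) (h0 : 0 ∉ Z) :
    ∃ f : (B → ℝ) →ₗ[ℝ] ℝ, (∀ i, 1 ≤ f (simpleRoot i)) ∧ ∀ z ∈ Z, f z ≠ 0 := by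
  let e := Fintype.equivFin B
  let p : (B → ℝ) → Polynomial ℝ := fun z ↦
    ∑ i, Polynomial.C (z i) * Polynomial.X ^ (e i : ℕ)
  have hp : ∀ z ∈ Z, p z ≠ 0 := by
    intro z hz hpz
    apply h0
    convert hz
    ext i
    have := congrArg (fun q : Polynomial ℝ ↦ q.coeff (e i)) hpz
    simpa [p, Polynomial.finsetSum_coeff, Polynomial.coeff_X_pow, Fin.val_inj,
      eq_comm] using this.symm
  have hc : (⋃ z ∈ Z, {t | (p z).IsRoot t}).Countable :=
    hZ.biUnion fun z hz ↦ (Polynomial.finite_setOfPred_isRoot (hp z hz)).countable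
  obtain ⟨t, ht, ht1⟩ := (hc.dense_compl ℝ).exists_mem_open isOpen_Ioi
    (Set.nonempty_Ioi (a := (1 : ℝ)))
  refine ⟨∑ i, t ^ (e i : ℕ) • LinearMap.proj i, fun i ↦ ?_, fun z hz h ↦ ht ?_⟩
  · simpa [simpleRoot, Pi.single_apply] using one_le_pow₀ (le_of_lt ht1)
  · simp only [Set.mem_iUnion]
    refine ⟨z, hz, ?_⟩
    rw [LinearMap.sum_apply] at h
    rw [Set.mem_ofPred_eq, Polynomial.IsRoot, Polynomial.eval_finsetSum, ← h]
    refine Finset.sum_congr rfl fun i _ ↦ ?_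
    simp only [Polynomial.eval_mul, Polynomial.eval_C, Polynomial.eval_pow, Polynomial.eval_X,
      LinearMap.smul_apply, LinearMap.proj_apply, smul_eq_mul, mul_comm]

theorem exists_forall_sum_window_pos {a : ℤ → ℝ} (hF : {m | a m < 1}.Finite) :
    ∃ N : ℕ, ∀ n ≥ N, ∀ l : ℤ, 0 < ∑ k ∈ Finset.range n, a (l + k) := by
  classical
  set F := hF.toFinset with hFdef
  obtain ⟨N, hN⟩ := exists_nat_gt (∑ m ∈ F, |1 - a m|)
  refine ⟨N, fun n hn l ↦ ?_⟩
  set b : ℤ → ℝ := fun m ↦ if m ∈ F then |1 - a m| else 0 with hb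
  have hab : ∀ m, 1 - b m ≤ a m := by
    intro m
    by_cases hm : m ∈ F
    · simp only [hb, hm, if_true]
      linarith [le_abs_self (1 - a m)]
    · simp only [hb, hm, if_false]
      simp only [hFdef, Set.Finite.mem_toFinset, Set.mem_ofPred_eq, not_lt] at hm
      linarith
  have hwin : ∑ k ∈ Finset.range n, b (l + k) ≤ ∑ m ∈ F, |1 - a m| := by
    have hinj : Set.InjOn (fun k : ℕ ↦ l + (k : ℤ)) (Finset.range n) := fun i _ j _ h ↦ by
      simpa using h
    rw [← Finset.sum_image (f := b) hinj, hb, Finset.sum_ite_mem]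
    exact Finset.sum_le_sum_of_subset_of_nonneg Finset.inter_subset_right
      fun _ _ _ ↦ abs_nonneg _
  have hsum : ∑ k ∈ Finset.range n, (1 - b (l + k)) ≤ ∑ k ∈ Finset.range n, a (l + k) :=
    Finset.sum_le_sum fun k _ ↦ hab _
  rw [Finset.sum_sub_distrib, Finset.sum_const, Finset.card_range, nsmul_eq_mul, mul_one] at hsum
  have : (N : ℝ) ≤ n := by exact_mod_cast hn
  linarith

end Generic

section OrbitSum

variable {B W : Type*} [Group W]

/-- The functional `∑ k < n, f ∘ ρ (w ^ k)`. -/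
noncomputable def orbitSum (ρ : W →* Module.End ℝ (B → ℝ)) (f : (B → ℝ) →ₗ[ℝ] ℝ) (w : W)
    (n : ℕ) : (B → ℝ) →ₗ[ℝ] ℝ :=
  ∑ k ∈ Finset.range n, f ∘ₗ ρ (w ^ k)

/-- The sign of the functional `x` is constant along the `w`-orbit of `β`. -/
def SignConstant (ρ : W →* Module.End ℝ (B → ℝ)) (x : (B → ℝ) →ₗ[ℝ] ℝ) (w : W)
    (β : B → ℝ) : Prop :=
  ∀ l l' : ℤ, SignType.sign (x (ρ (w ^ l) β)) = SignType.sign (x (ρ (w ^ l') β))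

variable {ρ : W →* Module.End ℝ (B → ℝ)} {f : (B → ℝ) →ₗ[ℝ] ℝ} {w : W}

theorem orbitSum_apply (n : ℕ) (v : B → ℝ) :
    orbitSum ρ f w n v = ∑ k ∈ Finset.range n, f (ρ (w ^ k) v) := by
  simp [orbitSum]

theorem orbitSum_rep_zpow (n : ℕ) (l : ℤ) (v : B → ℝ) :
    orbitSum ρ f w n (ρ (w ^ l) v) = ∑ k ∈ Finset.range n, f (ρ (w ^ (l + k)) v) := by
  rw [orbitSum_apply]
  refine Finset.sum_congr rfl fun k _ ↦ ?_
  rw [← rep_mul_apply, ← zpow_natCast, ← zpow_add, add_comm]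

theorem orbitSum_rep (n : ℕ) (v : B → ℝ) :
    orbitSum ρ f w n (ρ w v) = orbitSum ρ f w n v + (f (ρ (w ^ n) v) - f v) := by
  have := Finset.sum_range_sub (fun k ↦ f (ρ (w ^ k) v)) n
  simp only [pow_zero, map_one, Module.End.one_apply, Finset.sum_sub_distrib] at this
  rw [orbitSum_apply, orbitSum_apply, ← this]
  simp only [← rep_mul_apply, ← pow_succ]
  ring

theorem IsPeriodic.exists_signConstant {β : B → ℝ} (h : IsPeriodic ρ w β) :
    ∃ p : ℕ, 0 < p ∧ ∀ n, p ∣ n → SignConstant ρ (orbitSum ρ f w n) w β := by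
  obtain ⟨p, hp, hβ⟩ := h
  refine ⟨p, hp, ?_⟩
  rintro _ ⟨q, rfl⟩
  have hfix : ρ (w ^ (p * q)) β = β := by
    induction q with
    | zero => simp
    | succ q ih => rw [mul_add, mul_one, pow_add, rep_mul_apply, hβ, ih]
  have hper : Function.Periodic (fun l : ℤ ↦ orbitSum ρ f w (p * q) (ρ (w ^ l) β)) 1 := by
    intro l
    have hcomm : ρ (w ^ (p * q)) (ρ (w ^ l) β) = ρ (w ^ l) β := by
      rw [← rep_mul_apply, ((Commute.refl w).pow_left _ |>.zpow_right l).eq, rep_mul_apply, hfix]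
    simp only
    rw [add_comm, zpow_add, zpow_one, rep_mul_apply, orbitSum_rep, hcomm, sub_self, add_zero]
  have key : ∀ l : ℤ, orbitSum ρ f w (p * q) (ρ (w ^ l) β) =
      orbitSum ρ f w (p * q) (ρ (w ^ (0 : ℤ)) β) := fun l ↦ by
    simpa using hper.int_mul_eq l
  intro l l'
  rw [key l, key l']

theorem signConstant_rep_zpow {x : (B → ℝ) →ₗ[ℝ] ℝ} {β : B → ℝ} (m : ℤ) :
    SignConstant ρ x w (ρ (w ^ m) β) ↔ SignConstant ρ x w β := by
  simp only [SignConstant, ← rep_mul_apply, ← zpow_add]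
  refine ⟨fun h l l' ↦ ?_, fun h l l' ↦ h _ _⟩
  simpa using h (l - m) (l' - m)

theorem signConstant_neg {x : (B → ℝ) →ₗ[ℝ] ℝ} {β : B → ℝ} :
    SignConstant ρ x w (-β) ↔ SignConstant ρ x w β := by
  simp [SignConstant, Left.sign_neg]

theorem signConstant_of_forall_pos {x : (B → ℝ) →ₗ[ℝ] ℝ} {β : B → ℝ}
    (h : ∀ l : ℤ, 0 < x (ρ (w ^ l) β)) : SignConstant ρ x w β := fun l l' ↦ by
  rw [sign_pos (h l), sign_pos (h l')]

theorem sum_rep_pow_ne_zero {β : B → ℝ} (h : ¬ IsPeriodic ρ w β) {n : ℕ} (hn : 0 < n) :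
    ∑ k ∈ Finset.range n, ρ (w ^ k) β ≠ 0 := by
  intro h0
  refine h ⟨n, hn, ?_⟩
  have hsum := Finset.sum_range_sub (fun k ↦ ρ (w ^ k) β) n
  have h1 : ∑ k ∈ Finset.range n, ρ (w ^ (k + 1)) β = 0 := by
    rw [← map_zero (ρ w), ← h0, map_sum]
    simp only [pow_succ', rep_mul_apply]
  rw [Finset.sum_sub_distrib, h0, h1] at hsum
  rw [sub_self, pow_zero, map_one, Module.End.one_apply] at hsum
  exact sub_eq_zero.mp hsum.symm

theorem isPeriodic_rep {β : B → ℝ} : IsPeriodic ρ w (ρ w β) ↔ IsPeriodic ρ w β := by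
  simp only [IsPeriodic, ← rep_mul_apply, ← pow_succ, pow_succ']
  refine exists_congr fun m ↦ and_congr_right fun _ ↦ ⟨fun h ↦ ?_, fun h ↦ ?_⟩
  · simpa [← rep_mul_apply] using congrArg (ρ w⁻¹) h
  · rw [rep_mul_apply, h]

theorem IsEssential.conj {M : CoxeterMatrix B} {cs : CoxeterSystem M W} {w : W}
    (hw : IsEssential cs w) (y : W) : IsEssential cs (y⁻¹ * w * y) := by
  rintro P ⟨x, I, rfl⟩ hP hmem
  have hcomp : Subgroup.map (MulAut.conj (y * x)).toMonoidHom
      (Subgroup.closure (cs.simple '' I)) = Subgroup.map (MulAut.conj y).toMonoidHom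
        (Subgroup.map (MulAut.conj x).toMonoidHom (Subgroup.closure (cs.simple '' I))) := by
    rw [Subgroup.map_map, map_mul]
    rfl
  refine hw _ ⟨y * x, I, rfl⟩ ?_ ?_
  · rw [hcomp]
    intro htop
    apply hP
    apply Subgroup.map_injective (f := (MulAut.conj y).toMonoidHom) (MulAut.conj y).injective
    rw [Subgroup.map_top_of_surjective _ (MulAut.conj y).surjective]
    exact htop
  · rw [hcomp]
    refine ⟨_, hmem, ?_⟩
    simp [mul_assoc]

end OrbitSum

section Axis

variable {B W : Type*} [Fintype B] [DecidableEq B] [Group W] {M : CoxeterMatrix B}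
  {cs : CoxeterSystem M W} {ρ : W →* Module.End ℝ (B → ℝ)} {f : (B → ℝ) →ₗ[ℝ] ℝ}

theorem IsRoot.one_le_apply (hρ : IsGeometricRep cs ρ) (hf : ∀ i, 1 ≤ f (simpleRoot i))
    {β : B → ℝ} (hβ : IsRoot ρ β) (hpos : IsPositiveVec β) : 1 ≤ f β := by
  refine (hβ.one_le_sum_abs hρ).trans ?_
  rw [apply_eq_sum]
  refine Finset.sum_le_sum fun i _ ↦ ?_
  rw [abs_of_nonneg (hpos i)]
  exact le_mul_of_one_le_right (hpos i) (hf i)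

theorem eventually_signConstant_of_finite (hρ : IsGeometricRep cs ρ)
    (hf : ∀ i, 1 ≤ f (simpleRoot i)) {β : B → ℝ} (hβ : IsRoot ρ β) {w : W}
    (h : {m : ℤ | ¬ IsPositiveVec (ρ (w ^ m) β)}.Finite) :
    ∀ᶠ n in Filter.atTop, SignConstant ρ (orbitSum ρ f w n) w β := by
  have hfin : {m : ℤ | f (ρ (w ^ m) β) < 1}.Finite := by
    refine h.subset fun m hm hpos ↦ ?_
    exact absurd ((hβ.rep _).one_le_apply hρ hf hpos) (not_le.mpr hm)
  obtain ⟨N, hN⟩ := exists_forall_sum_window_pos hfin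
  filter_upwards [Filter.eventually_ge_atTop N] with n hn
  exact signConstant_of_forall_pos fun l ↦ by
    rw [orbitSum_rep_zpow]
    exact hN n hn l

theorem eventually_signConstant (hρ : IsGeometricRep cs ρ) (hf : ∀ i, 1 ≤ f (simpleRoot i))
    {β : B → ℝ} (hβ : IsRoot ρ β) {w : W} (h : ¬ IsWOdd ρ w β) :
    ∀ᶠ T : ℕ in Filter.atTop, SignConstant ρ (orbitSum ρ f w T.factorial) w β := by
  by_cases hper : IsPeriodic ρ w β
  · obtain ⟨p, hp, hgood⟩ := hper.exists_signConstant (f := f)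
    filter_upwards [Filter.eventually_ge_atTop p] with T hT
    exact hgood _ (Nat.dvd_factorial hp hT)
  · have htend : Filter.Tendsto Nat.factorial Filter.atTop Filter.atTop :=
      Filter.tendsto_atTop_mono Nat.self_le_factorial Filter.tendsto_id
    rcases exists_finite_of_not_isWOdd hρ hβ hper h with hfin | hfin
    · exact htend.eventually (eventually_signConstant_of_finite hρ hf hβ hfin)
    · have hneg : {m : ℤ | ¬ IsPositiveVec (ρ (w ^ m) (-β))}.Finite := by
        simpa only [map_neg, isPositiveVec_neg] using hfin
      filter_upwards [htend.eventually
        (eventually_signConstant_of_finite hρ hf (hβ.neg hρ) hneg)] with T hT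
      exact signConstant_neg.mp hT

theorem exists_forall_signConstant (hρ : IsGeometricRep cs ρ) (hf : ∀ i, 1 ≤ f (simpleRoot i))
    (w : W) :
    ∃ n, 0 < n ∧ ∀ β, IsRoot ρ β → ¬ IsWOdd ρ w β → SignConstant ρ (orbitSum ρ f w n) w β := by
  have hev : ∀ γ ∈ inversionSet ρ w, ∀ᶠ T : ℕ in Filter.atTop,
      (∃ β, IsRoot ρ β ∧ ¬ IsWOdd ρ w β ∧ ∃ m : ℤ, γ = ρ (w ^ m) β ∨ γ = -ρ (w ^ m) β) →
        SignConstant ρ (orbitSum ρ f w T.factorial) w γ := by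
    intro γ _
    by_cases hex : ∃ β, IsRoot ρ β ∧ ¬ IsWOdd ρ w β ∧
        ∃ m : ℤ, γ = ρ (w ^ m) β ∨ γ = -ρ (w ^ m) β
    · obtain ⟨β, hβ, hodd, m, hm⟩ := hex
      filter_upwards [eventually_signConstant hρ hf hβ hodd] with T hT _
      rcases hm with rfl | rfl
      · rwa [signConstant_rep_zpow]
      · rwa [signConstant_neg, signConstant_rep_zpow]
    · exact Filter.Eventually.of_forall fun T h ↦ absurd h hex
  obtain ⟨T, hT⟩ := ((finite_inversionSet hρ w).eventually_all.mpr hev).exists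
  refine ⟨T.factorial, T.factorial_pos, fun β hβ hodd ↦ ?_⟩
  by_cases hch : ∃ m : ℤ, ¬(IsPositiveVec (ρ (w ^ m) β) ↔ IsPositiveVec (ρ (w ^ (m + 1)) β))
  · obtain ⟨m, hm⟩ := hch
    rcases mem_inversionSet_of_changes hρ hβ hm with hmem | hmem
    · exact (signConstant_rep_zpow m).mp (hT _ hmem ⟨β, hβ, hodd, m, Or.inl rfl⟩)
    · exact (signConstant_rep_zpow m).mp
        (signConstant_neg.mp (hT _ hmem ⟨β, hβ, hodd, m, Or.inr rfl⟩))
  · push Not at hch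
    have hpos : ∀ γ, IsRoot ρ γ → (∀ m : ℤ, IsPositiveVec (ρ (w ^ m) γ)) →
        SignConstant ρ (orbitSum ρ f w T.factorial) w γ := fun γ hγ hall ↦
      signConstant_of_forall_pos fun l ↦ by
        rw [orbitSum_rep_zpow]
        refine Finset.sum_pos (fun k _ ↦ ?_) ⟨0, by simp [T.factorial_pos]⟩
        exact zero_lt_one.trans_le ((hγ.rep _).one_le_apply hρ hf (hall _))
    have hper : Function.Periodic (fun m : ℤ ↦ IsPositiveVec (ρ (w ^ m) β)) 1 := fun m ↦
      propext (hch m).symm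
    have hconst : ∀ m : ℤ, IsPositiveVec (ρ (w ^ m) β) ↔ IsPositiveVec β := fun m ↦ by
      simpa using hper.int_mul_eq m
    by_cases h0 : IsPositiveVec β
    · exact hpos β hβ fun m ↦ (hconst m).mpr h0
    · refine signConstant_neg.mp (hpos (-β) (hβ.neg hρ) fun m ↦ ?_)
      rw [map_neg, isPositiveVec_neg, ← (hβ.rep _).not_pos_iff hρ, hconst m]
      exact h0

theorem orbitSum_ge_of_not_mem_inversionSet (hρ : IsGeometricRep cs ρ)
    (hf : ∀ i, 1 ≤ f (simpleRoot i)) {w : W} {n : ℕ} {β : B → ℝ} (hβ : IsRoot ρ β)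
    (hpos : IsPositiveVec β) (h : ∀ k < n, β ∉ inversionSet ρ (w ^ k)) :
    (n : ℝ) ≤ orbitSum ρ f w n β := by
  have : ∑ _k ∈ Finset.range n, (1 : ℝ) ≤ orbitSum ρ f w n β := by
    rw [orbitSum_apply]
    refine Finset.sum_le_sum fun k hk ↦ (hβ.rep _).one_le_apply hρ hf ?_
    rw [← (hβ.rep _).not_neg_iff hρ]
    exact fun hneg ↦ h k (Finset.mem_range.mp hk) ⟨hβ, hpos, hneg⟩
  simpa using this

theorem finite_iUnion_inversionSet_pow (hρ : IsGeometricRep cs ρ) (w : W) (n : ℕ) :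
    (⋃ k ∈ Finset.range n, inversionSet ρ (w ^ k)).Finite :=
  (Finset.range n).finite_toSet.biUnion fun k _ ↦ finite_inversionSet hρ (w ^ k)

theorem finite_neg_roots_orbitSum (hρ : IsGeometricRep cs ρ) (hf : ∀ i, 1 ≤ f (simpleRoot i))
    (w : W) (n : ℕ) :
    {β | IsRoot ρ β ∧ IsPositiveVec β ∧ orbitSum ρ f w n β < 0}.Finite := by
  refine (finite_iUnion_inversionSet_pow hρ w n).subset fun β hβ ↦ ?_
  obtain ⟨hr, hp, hlt⟩ := hβ
  by_contra hmem
  simp only [Set.mem_iUnion, not_exists, Finset.mem_range] at hmem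
  have := orbitSum_ge_of_not_mem_inversionSet hρ hf hr hp hmem
  have : (0 : ℝ) ≤ n := Nat.cast_nonneg n
  linarith

theorem exists_orbitSum_ne_zero [Infinite W] (hρ : IsGeometricRep cs ρ)
    (hf : ∀ i, 1 ≤ f (simpleRoot i)) (w : W) {n : ℕ} (hn : 0 < n) :
    ∃ β, orbitSum ρ f w n β ≠ 0 := by
  have hfin := finite_iUnion_inversionSet_pow hρ w n
  obtain ⟨β, hβ, hmem⟩ :=
    ((infinite_roots hρ).sdiff (hfin.union (hfin.preimage neg_injective.injOn))).nonempty
  simp only [Set.mem_union, Set.mem_preimage, Set.mem_iUnion, not_or, not_exists,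
    Finset.mem_range] at hmem
  have hn' : (0 : ℝ) < n := Nat.cast_pos.mpr hn
  rcases IsRoot.pos_or_neg hρ hβ with hp | hp
  · exact ⟨β, (hn'.trans_le (orbitSum_ge_of_not_mem_inversionSet hρ hf hβ hp hmem.1)).ne'⟩
  · exact ⟨-β, (hn'.trans_le (orbitSum_ge_of_not_mem_inversionSet hρ hf (IsRoot.neg hρ hβ)
      (isPositiveVec_neg.mpr hp) hmem.2)).ne'⟩

theorem exists_rep_dominant (hρ : IsGeometricRep cs ρ) (x : (B → ℝ) →ₗ[ℝ] ℝ)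
    (hfin : {β | IsRoot ρ β ∧ IsPositiveVec β ∧ x β < 0}.Finite) :
    ∃ y : W, ∀ i, 0 ≤ x (ρ y (simpleRoot i)) := by
  induction hN : {β | IsRoot ρ β ∧ IsPositiveVec β ∧ x β < 0}.ncard using Nat.strong_induction_on
    generalizing x with
  | _ N ih =>
  by_cases hdom : ∀ i, 0 ≤ x (simpleRoot i)
  · exact ⟨1, by simpa using hdom⟩
  push Not at hdom
  obtain ⟨i, hi⟩ := hdom
  have hsi : ∀ v, ρ (cs.simple i) (ρ (cs.simple i) v) = v := fun v ↦ by
    rw [← rep_mul_apply, cs.simple_mul_simple_self, map_one, Module.End.one_apply]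
  have hinj : Function.Injective (ρ (cs.simple i)) := Function.LeftInverse.injective hsi
  have hmaps : (ρ (cs.simple i)) '' {β | IsRoot ρ β ∧ IsPositiveVec β ∧
      (x ∘ₗ ρ (cs.simple i)) β < 0} ⊂ {β | IsRoot ρ β ∧ IsPositiveVec β ∧ x β < 0} := by
    have hne : ∀ β, (x ∘ₗ ρ (cs.simple i)) β < 0 → β ≠ simpleRoot i := by
      rintro _ hlt rfl
      rw [LinearMap.comp_apply, rep_simple_simpleRoot hρ, map_neg] at hlt
      linarith
    refine (Set.ssubset_iff_of_subset ?_).mpr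
      ⟨simpleRoot i, ⟨isRoot_simpleRoot ρ i, isPositiveVec_simpleRoot i, hi⟩, ?_⟩
    · rintro _ ⟨β, ⟨hr, hp, hlt⟩, rfl⟩
      exact ⟨hr.rep _, hr.rep_simple_pos hρ hp (hne β hlt), hlt⟩
    · rintro ⟨β, ⟨hr, hp, hlt⟩, he⟩
      have hp' := hr.rep_simple_pos hρ hp (hne β hlt)
      have hβ : β = -simpleRoot i := by
        rw [← hsi β, he, rep_simple_simpleRoot hρ]
      rw [hβ, isPositiveVec_neg] at hp
      exact ((isRoot_simpleRoot ρ i).not_neg_iff hρ).mpr (isPositiveVec_simpleRoot i) hp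
  have hlt := Set.ncard_lt_ncard hmaps hfin
  rw [Set.ncard_image_of_injective _ hinj, hN] at hlt
  obtain ⟨y, hy⟩ := ih _ hlt (x ∘ₗ ρ (cs.simple i))
    ((hfin.subset hmaps.subset).of_finite_image hinj.injOn) rfl
  refine ⟨cs.simple i * y, fun j ↦ ?_⟩
  rw [rep_mul_apply]
  exact hy j

theorem countable_orbit_sums [Countable W] (w : W) :
    {z : B → ℝ | ∃ (n : ℕ) (β : B → ℝ), IsRoot ρ β ∧
      z = ∑ k ∈ Finset.range n, ρ (w ^ k) β}.Countable := by
  refine (Set.countable_range fun p : ℕ × W × B ↦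
    ∑ k ∈ Finset.range p.1, ρ (w ^ k) (ρ p.2.1 (simpleRoot p.2.2))).mono ?_
  rintro _ ⟨n, _, ⟨u, i, rfl⟩, rfl⟩
  exact ⟨(n, u, i), rfl⟩

theorem IsEssential.closure_eq_top [Infinite W] (hρ : IsGeometricRep cs ρ)
    (hirr : IsIrreducible M) {w : W} (hw : IsEssential cs w) :
    Subgroup.closure {t : W | ∃ (x : W) (i : B), t = x * cs.simple i * x⁻¹ ∧
      IsPositiveVec (ρ x (simpleRoot i)) ∧ IsWOdd ρ w (ρ x (simpleRoot i))} = ⊤ := by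
  have : Countable W := cs.wordProd_surjective.countable
  obtain ⟨f, hf, hgen⟩ := exists_generic_functional
    ((countable_orbit_sums (ρ := ρ) w).mono (Set.sdiff_subset (t := {0}))) (by simp)
  obtain ⟨n, hn, hgood⟩ := exists_forall_signConstant hρ hf w
  set x := orbitSum ρ f w n with hx
  obtain ⟨y, hy⟩ := exists_rep_dominant hρ x (finite_neg_roots_orbitSum hρ hf w n)
  have hne0 : ∀ β, IsRoot ρ β → ¬ IsPeriodic ρ w β → x β ≠ 0 := by
    intro β hβ hper
    rw [hx, orbitSum_apply, ← map_sum]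
    exact hgen _ ⟨⟨n, β, hβ, rfl⟩, sum_rep_pow_ne_zero hper hn⟩
  have hconj : ∀ v, ρ y (ρ (y⁻¹ * w * y) v) = ρ w (ρ y v) := fun v ↦ by
    rw [← rep_mul_apply, ← rep_mul_apply]
    congr 2
    group
  have hconj' : ∀ v, ρ y (ρ (y⁻¹ * w * y)⁻¹ v) = ρ w⁻¹ (ρ y v) := fun v ↦ by
    rw [← rep_mul_apply, ← rep_mul_apply]
    congr 2
    group
  have hcore := (hw.conj y).closure_eq_top_of_axis hρ hirr (x ∘ₗ ρ y) hy
    (O := fun β ↦ IsWOdd ρ w (ρ y β)) ?_ ?_ ?_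
  · set G := Subgroup.closure {t : W | ∃ (x : W) (i : B), t = x * cs.simple i * x⁻¹ ∧
      IsPositiveVec (ρ x (simpleRoot i)) ∧ IsWOdd ρ w (ρ x (simpleRoot i))} with hG
    have hle : (⊤ : Subgroup W) ≤ G.comap (MulAut.conj y).toMonoidHom := by
      rw [← hcore, Subgroup.closure_le]
      rintro _ ⟨u, i, rfl, -, hodd⟩
      rw [← rep_mul_apply] at hodd
      refine Subgroup.subset_closure ?_
      rcases ((isRoot_simpleRoot ρ i).rep (y * u)).pos_or_neg hρ with hp | hp
      · exact ⟨y * u, i, by simp [mul_assoc], hp, hodd⟩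
      · refine ⟨y * u * cs.simple i, i, by simp [mul_assoc], ?_, ?_⟩
        · rw [rep_mul_apply, rep_simple_simpleRoot hρ, map_neg, isPositiveVec_neg]
          exact hp
        · rw [rep_mul_apply, rep_simple_simpleRoot hρ, map_neg, isWOdd_neg]
          exact hodd
    rw [eq_top_iff]
    intro t _
    have := hle (Subgroup.mem_top (y⁻¹ * t * y))
    simpa [mul_assoc] using this
  · by_contra! hall
    obtain ⟨β, hβ⟩ := exists_orbitSum_ne_zero hρ hf w hn
    apply hβ
    have : (x ∘ₗ ρ y) (ρ y⁻¹ β) = 0 := by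
      rw [apply_eq_sum]
      exact Finset.sum_eq_zero fun i _ ↦ by rw [hall i, mul_zero]
    rwa [LinearMap.comp_apply, rep_apply_rep_inv] at this
  · intro β hβ
    rw [LinearMap.comp_apply, LinearMap.comp_apply, hconj]
    by_cases hodd : IsWOdd ρ w (ρ y β)
    · exact iff_of_false (hne0 _ ((hβ.rep y).rep w) (isPeriodic_rep.not.mpr hodd.1))
        (hne0 _ (hβ.rep y) hodd.1)
    · have := hgood _ (hβ.rep y) hodd 1 0
      rw [zpow_one, zpow_zero, map_one, Module.End.one_apply] at this
      rw [← sign_eq_zero_iff, this, sign_eq_zero_iff]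
  · intro β hβ hpos hneg
    rw [LinearMap.comp_apply] at hpos hneg
    rw [hconj'] at hneg
    by_contra hodd
    have := hgood _ (hβ.rep y) hodd (-1) 0
    rw [zpow_neg_one, zpow_zero, map_one, Module.End.one_apply, sign_pos hpos,
      sign_neg hneg] at this
    exact absurd this (by decide)

end Axis

/-- In an irreducible, infinite Coxeter group, an element `w` is
essential if and only if `W` is generated by the reflections `t_α` corresponding to
positive `w`-odd roots `α`. -/
theorem isEssential_iff_generated_by_odd_reflections
    {B W : Type*} [Fintype B] [DecidableEq B] [Group W] {M : CoxeterMatrix B}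
    (cs : CoxeterSystem M W) (hirr : IsIrreducible M) (hinf : Infinite W)
    (ρ : W →* Module.End ℝ (B → ℝ)) (hρ : IsGeometricRep cs ρ) (w : W) :
    IsEssential cs w ↔
      Subgroup.closure {t : W | ∃ (x : W) (i : B), t = x * cs.simple i * x⁻¹ ∧
        IsPositiveVec (ρ x (simpleRoot i)) ∧ IsWOdd ρ w (ρ x (simpleRoot i))} = ⊤ := by
  have := hinf
  exact ⟨fun h ↦ h.closure_eq_top hρ hirr, isEssential_of_closure_eq_top hρ⟩

end CoxeterPaper
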